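/- arXiv:1710.03849 — 5 statements merged into one kernel-verified Lean document; each statement's English description precedes it below -/
import Mathlib

section
/- Let n ≥ 2 and let S be an irreducible semigroup of triangularizable matrices in M_n(ℝ) such that S is topologically closed and closed under multiplication by real scalars (equivalently, S equals the topological closure of ℝ·S). Then S contains a nonzero singular matrix, i.e., there exists A ∈ S with A ≠ 0 and A not invertible. -/
open Matrix Polynomial

/-- In a normed algebra, a unipotent element with bounded powers is `1`. -/
theorem eq_zero_of_isNilpotent_of_norm_one_add_pow_le {R : Type*} [NormedRing R]
    [NormedAlgebra ℝ R] {N : R} (hN : IsNilpotent N) {C : ℝ} (hC : ∀ k : ℕ, ‖(1 + N) ^ k‖ ≤ C) :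
    N = 0 := by
  have step : ∀ j : ℕ, N ^ (j + 2) = 0 → N ^ (j + 1) = 0 := by
    intro j hj
    have hpow : ∀ k : ℕ, (1 + N) ^ k * N ^ j = N ^ j + (k : ℝ) • N ^ (j + 1) := by
      intro k
      induction k with
      | zero => simp
      | succ k ih =>
        rw [pow_succ', mul_assoc, ih, add_mul, one_mul, mul_add, mul_smul_comm, ← pow_succ',
          ← pow_succ', hj]
        push_cast
        module
    by_contra hne
    have hpos : 0 < ‖N ^ (j + 1)‖ := norm_pos_iff.mpr hne
    obtain ⟨k, hk⟩ := exists_nat_gt ((C * ‖N ^ j‖ + ‖N ^ j‖) / ‖N ^ (j + 1)‖)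
    rw [div_lt_iff₀ hpos] at hk
    have h1 : (k : ℝ) • N ^ (j + 1) = (1 + N) ^ k * N ^ j - N ^ j := by rw [hpow]; abel
    have h2 : (k : ℝ) * ‖N ^ (j + 1)‖ ≤ C * ‖N ^ j‖ + ‖N ^ j‖ := by
      calc (k : ℝ) * ‖N ^ (j + 1)‖ = ‖(k : ℝ) • N ^ (j + 1)‖ := by simp [norm_smul]
        _ ≤ ‖(1 + N) ^ k * N ^ j‖ + ‖N ^ j‖ := h1 ▸ norm_sub_le _ _
        _ ≤ C * ‖N ^ j‖ + ‖N ^ j‖ := by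
          gcongr
          exact (norm_mul_le _ _).trans (by gcongr; exact hC k)
    linarith
  obtain ⟨m, hm⟩ := hN
  have descend : ∀ j : ℕ, N ^ (j + 1) = 0 → N = 0 := by
    intro j
    induction j with
    | zero => simp
    | succ j ih => exact fun h => ih (step j h)
  exact descend m (by rw [pow_succ, hm, zero_mul])

theorem abs_le_one_of_abs_pow_le {d C : ℝ} (h : ∀ k : ℕ, |d ^ k| ≤ C) : |d| ≤ 1 := by
  by_contra! hd
  obtain ⟨k, hk⟩ := pow_unbounded_of_one_lt C hd
  exact absurd (h k) (by rw [abs_pow]; exact hk.not_ge)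

namespace Matrix

variable {n : ℕ}

theorem BlockTriangular.mul_apply_diag {R : Type*} [CommRing R] {A B : Matrix (Fin n) (Fin n) R}
    (hA : A.BlockTriangular id) (hB : B.BlockTriangular id) (i : Fin n) :
    (A * B) i i = A i i * B i i := by
  rw [mul_apply]
  refine Finset.sum_eq_single i (fun j _ hj => ?_) (by simp)
  rcases lt_or_gt_of_ne hj with h | h
  · rw [hA h, zero_mul]
  · rw [hB h, mul_zero]

theorem BlockTriangular.pow_apply_diag {R : Type*} [CommRing R] {A : Matrix (Fin n) (Fin n) R}
    (hA : A.BlockTriangular id) (k : ℕ) (i : Fin n) : (A ^ k) i i = A i i ^ k := by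
  induction k with
  | zero => simp
  | succ k ih => rw [pow_succ, (hA.pow k).mul_apply_diag hA, ih, pow_succ]

theorem BlockTriangular.isNilpotent_of_diag_eq_zero {R : Type*} [CommRing R]
    {A : Matrix (Fin n) (Fin n) R} (hA : A.BlockTriangular id) (h : ∀ i, A i i = 0) :
    IsNilpotent A := by
  refine ⟨n, ?_⟩
  have := aeval_self_charpoly A
  rw [charpoly_of_isUpperTriangular A hA] at this
  simpa [h] using this

open scoped Matrix.Norms.Operator

/-- An upper triangular real matrix with bounded powers and determinant `±1` is an involution. -/
theorem BlockTriangular.mul_self_eq_one_of_norm_pow_le {T : Matrix (Fin n) (Fin n) ℝ}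
    (hT : T.BlockTriangular id) (hdet : |T.det| = 1) {C : ℝ} (hC : ∀ k : ℕ, ‖T ^ k‖ ≤ C) :
    T * T = 1 := by
  have hle : ∀ i, |T i i| ≤ 1 := fun i => by
    refine abs_le_one_of_abs_pow_le (C := C) fun k => ?_
    rw [← hT.pow_apply_diag]
    refine le_trans ?_ (hC k)
    have hcol := linfty_opNorm_mulVec (T ^ k) (Pi.single i (1 : ℝ))
    rw [Pi.norm_single, norm_one, mul_one] at hcol
    simpa using (norm_le_pi_norm _ i).trans hcol
  have habs : ∀ i, |T i i| = 1 := fun i => by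
    refine le_antisymm (hle i) ?_
    rw [det_of_isUpperTriangular hT, Finset.abs_prod,
      ← Finset.mul_prod_erase _ _ (Finset.mem_univ i)] at hdet
    rw [← hdet]
    exact mul_le_of_le_one_right (abs_nonneg _)
      (Finset.prod_le_one (fun _ _ => abs_nonneg _) fun j _ => hle j)
  have hnil : IsNilpotent (T * T - 1) := by
    refine ((hT.mul hT).sub blockTriangular_one).isNilpotent_of_diag_eq_zero fun i => ?_
    rw [sub_apply, hT.mul_apply_diag hT, one_apply_eq, ← abs_mul_abs_self, habs]
    norm_num
  refine sub_eq_zero.mp (eq_zero_of_isNilpotent_of_norm_one_add_pow_le hnil (C := C) fun k => ?_)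
  rw [add_sub_cancel, ← pow_two, ← pow_mul]
  exact hC _

theorem mul_self_eq_one_of_triangularizable {A : Matrix (Fin n) (Fin n) ℝ}
    (hA : ∃ P : (Matrix (Fin n) (Fin n) ℝ)ˣ,
      BlockTriangular ((↑P⁻¹ : Matrix (Fin n) (Fin n) ℝ) * A *
        (↑P : Matrix (Fin n) (Fin n) ℝ)) id)
    (hdet : |A.det| = 1) {C : ℝ} (hC : ∀ k : ℕ, ‖A ^ k‖ ≤ C) : A * A = 1 := by
  obtain ⟨P, hP⟩ := hA
  set Q : Matrix (Fin n) (Fin n) ℝ := ↑P⁻¹ with hQ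
  have hpow : ∀ k : ℕ, (Q * A * P) ^ k = Q * A ^ k * P := P.conj_pow' A
  have hdet' : |(Q * A * P).det| = 1 := by rwa [hQ, det_units_conj']
  have h := hP.mul_self_eq_one_of_norm_pow_le (C := ‖Q‖ * C * ‖(P : Matrix (Fin n) (Fin n) ℝ)‖) hdet' fun k => by
      rw [hpow]
      refine (norm_mul_le _ _).trans ?_
      gcongr
      exact (norm_mul_le _ _).trans (by gcongr; exact hC k)
  rw [← pow_two, hpow] at h
  calc A * A = P * (Q * A ^ 2 * P) * Q := by simp [hQ, mul_assoc, pow_two]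
    _ = 1 := by rw [h, mul_one, hQ, Units.mul_inv]

/-- In a closed real cone of matrices whose nonzero elements are all invertible, the elements of
determinant `±1` are bounded. -/
theorem exists_norm_le_of_abs_det_eq_one (hn : n ≠ 0) {S : Set (Matrix (Fin n) (Fin n) ℝ)}
    (hclosed : IsClosed S) (hscal : ∀ r : ℝ, ∀ A ∈ S, r • A ∈ S)
    (hunit : ∀ A ∈ S, A ≠ 0 → IsUnit A) :
    ∃ C : ℝ, ∀ A ∈ S, |A.det| = 1 → ‖A‖ ≤ C := by
  have : ProperSpace (Matrix (Fin n) (Fin n) ℝ) := FiniteDimensional.proper ℝ _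
  have hK : IsCompact (Metric.sphere 0 1 ∩ S) := (isCompact_sphere _ _).inter_right hclosed
  have hmem : ∀ A ∈ S, A ≠ 0 → ‖A‖⁻¹ • A ∈ Metric.sphere 0 1 ∩ S := fun A hA h0 =>
    ⟨by simp [norm_smul, h0], hscal _ A hA⟩
  rcases (Metric.sphere 0 1 ∩ S).eq_empty_or_nonempty with he | hne
  · refine ⟨0, fun A hA _ => ?_⟩
    by_contra h
    have h0 : A ≠ 0 := by rintro rfl; simp at h
    exact (he ▸ hmem A hA h0 : _ ∈ (∅ : Set (Matrix (Fin n) (Fin n) ℝ)))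
  · obtain ⟨B, ⟨hB1, hBS⟩, hmin⟩ := hK.exists_isMinOn hne
      (f := fun A => |A.det|) (by fun_prop)
    have hB0 : B ≠ 0 := by rintro rfl; simp at hB1
    have hc : 0 < |B.det| :=
      abs_pos.mpr ((isUnit_iff_isUnit_det B).mp (hunit B hBS hB0)).ne_zero
    refine ⟨max 1 |B.det|⁻¹, fun A hA hdet => ?_⟩
    rcases le_total ‖A‖ 1 with h | h
    · exact h.trans (le_max_left _ _)
    · have hpos : 0 < ‖A‖ := one_pos.trans_le h
      have hle := isMinOn_iff.mp hmin _ (hmem A hA (norm_pos_iff.mp hpos))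
      rw [det_smul, abs_mul, hdet, mul_one, Fintype.card_fin, abs_pow,
        abs_of_pos (inv_pos.mpr hpos), inv_pow] at hle
      exact (le_self_pow₀ h hn).trans
        ((le_inv_of_le_inv₀ hc hle).trans (le_max_right _ _))

/-- A closed real cone and semigroup of triangularizable matrices whose nonzero elements are all
invertible has only involutions among its elements of determinant `±1`. -/
theorem mul_self_eq_one_of_mem_of_abs_det_eq_one (hn : n ≠ 0)
    {S : Set (Matrix (Fin n) (Fin n) ℝ)} (hmul : ∀ A ∈ S, ∀ B ∈ S, A * B ∈ S)
    (htri : ∀ A ∈ S, ∃ P : (Matrix (Fin n) (Fin n) ℝ)ˣ,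
      BlockTriangular ((↑P⁻¹ : Matrix (Fin n) (Fin n) ℝ) * A *
        (↑P : Matrix (Fin n) (Fin n) ℝ)) id)
    (hclosed : IsClosed S) (hscal : ∀ r : ℝ, ∀ A ∈ S, r • A ∈ S)
    (hunit : ∀ A ∈ S, A ≠ 0 → IsUnit A) {A : Matrix (Fin n) (Fin n) ℝ} (hA : A ∈ S)
    (hdet : |A.det| = 1) : A * A = 1 := by
  obtain ⟨C, hC⟩ := exists_norm_le_of_abs_det_eq_one hn hclosed hscal hunit
  have hpow : ∀ k : ℕ, A ^ (k + 1) ∈ S := by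
    intro k
    induction k with
    | zero => simpa using hA
    | succ k ih => rw [pow_succ]; exact hmul _ ih _ hA
  refine mul_self_eq_one_of_triangularizable (htri A hA) hdet
    (C := max ‖(1 : Matrix (Fin n) (Fin n) ℝ)‖ C) fun k => ?_
  cases k with
  | zero => rw [pow_zero]; exact le_max_left _ _
  | succ k =>
    exact (hC _ (hpow k) (by simp [det_pow, hdet])).trans (le_max_right _ _)

theorem exists_abs_det_smul_eq_one (hn : n ≠ 0) {A : Matrix (Fin n) (Fin n) ℝ}
    (hA : A.det ≠ 0) : ∃ r : ℝ, r ≠ 0 ∧ |(r • A).det| = 1 := by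
  have hpos : 0 < |A.det|⁻¹ := inv_pos.mpr (abs_pos.mpr hA)
  refine ⟨|A.det|⁻¹ ^ ((n : ℝ)⁻¹), (Real.rpow_pos_of_pos hpos _).ne', ?_⟩
  rw [det_smul, Fintype.card_fin, Real.rpow_inv_natCast_pow hpos.le hn, abs_mul, abs_inv, abs_abs,
    inv_mul_cancel₀ (abs_ne_zero.mpr hA)]

end Matrix


/-- An irreducible semigroup of triangularizable matrices in `Mₙ(ℝ)` (`n ≥ 2`)
that is topologically closed and closed under multiplication by real scalars contains a
nonzero singular matrix. -/
theorem irreducible_closed_semigroup_contains_nonzero_singular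
    (n : ℕ) (hn : 2 ≤ n) (S : Set (Matrix (Fin n) (Fin n) ℝ))
    -- `S` is a multiplicative semigroup
    (hmul : ∀ A ∈ S, ∀ B ∈ S, A * B ∈ S)
    -- each member of `S` is triangularizable
    (htri : ∀ A ∈ S, ∃ P : (Matrix (Fin n) (Fin n) ℝ)ˣ,
      Matrix.BlockTriangular
        ((↑P⁻¹ : Matrix (Fin n) (Fin n) ℝ) * A * (↑P : Matrix (Fin n) (Fin n) ℝ)) id)
    -- `S` is irreducible
    (hne : S ≠ {0})
    (hirr : ∀ W : Submodule ℝ (Fin n → ℝ),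
      (∀ A ∈ S, ∀ x ∈ W, A.mulVec x ∈ W) → W = ⊥ ∨ W = ⊤)
    -- `S` is topologically closed and closed under real scalar multiplication
    (hclosed : IsClosed S)
    (hscal : ∀ (r : ℝ), ∀ A ∈ S, r • A ∈ S) :
    ∃ A ∈ S, A ≠ 0 ∧ ¬ IsUnit A := by
  by_contra! hunit
  have hn0 : n ≠ 0 := by omega
  have hinv : ∀ A ∈ S, |A.det| = 1 → A * A = 1 := fun A hA hdet =>
    mul_self_eq_one_of_mem_of_abs_det_eq_one hn0 hmul htri hclosed hscal hunit hA hdet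
  have hcomm : ∀ A ∈ S, |A.det| = 1 → ∀ B ∈ S, |B.det| = 1 → A * B = B * A := by
    intro A hA hdA B hB hdB
    have hAB := hinv (A * B) (hmul A hA B hB) (by rw [det_mul, abs_mul, hdA, hdB, one_mul])
    calc A * B = A * (A * B * (A * B)) * B := by rw [hAB, mul_one]
      _ = (A * A) * (B * A) * (B * B) := by noncomm_ring
      _ = B * A := by rw [hinv A hA hdA, hinv B hB hdB, one_mul, mul_one]
  have hnormalize : ∀ A ∈ S, A ≠ 0 → ∃ r : ℝ, r ≠ 0 ∧ |(r • A).det| = 1 := fun A hA h0 =>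
    exists_abs_det_smul_eq_one hn0 ((isUnit_iff_isUnit_det A).mp (hunit A hA h0)).ne_zero
  have hcomm' : ∀ A ∈ S, |A.det| = 1 → ∀ B ∈ S, A * B = B * A := by
    intro A hA hdA B hB
    rcases eq_or_ne B 0 with rfl | hB0
    · simp
    obtain ⟨r, hr, hdet⟩ := hnormalize B hB hB0
    have h := hcomm A hA hdA _ (hscal r B hB) hdet
    rw [mul_smul_comm, smul_mul_assoc] at h
    exact smul_right_injective _ hr h
  have hsign : ∀ A ∈ S, |A.det| = 1 → A = 1 ∨ A = -1 := by
    intro A hA hdA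
    have hker := hirr (LinearMap.ker (mulVecLin (A - 1))) fun B hB x hx => by
      simp only [LinearMap.mem_ker, mulVecLin_apply] at hx ⊢
      have hB' : (A - 1) * B = B * (A - 1) := by
        rw [sub_mul, mul_sub, hcomm' A hA hdA B hB, one_mul, mul_one]
      rw [mulVec_mulVec, hB', ← mulVec_mulVec, hx, mulVec_zero]
    rcases hker with hbot | htop
    · right
      have hzero : (A - 1) * (A + 1) = 0 := by
        rw [← sub_eq_zero.mpr (hinv A hA hdA)]; noncomm_ring
      refine eq_neg_of_add_eq_zero_left (ext_of_mulVec_single fun i => ?_)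
      rw [zero_mulVec, ← Submodule.mem_bot ℝ, ← hbot, LinearMap.mem_ker, mulVecLin_apply,
        mulVec_mulVec, hzero, zero_mulVec]
    · left
      refine sub_eq_zero.mp (ext_of_mulVec_single fun i => ?_)
      rw [zero_mulVec, ← mulVecLin_apply, LinearMap.ker_eq_top.mp htop, LinearMap.zero_apply]
  have hscalar : ∀ A ∈ S, ∃ c : ℝ, A = c • (1 : Matrix (Fin n) (Fin n) ℝ) := by
    intro A hA
    rcases eq_or_ne A 0 with rfl | hA0
    · exact ⟨0, by simp⟩
    obtain ⟨r, hr, hdet⟩ := hnormalize A hA hA0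
    rcases hsign _ (hscal r A hA) hdet with h | h
    · exact ⟨r⁻¹, by rw [← h, inv_smul_smul₀ hr]⟩
    · exact ⟨-r⁻¹, by rw [neg_smul, ← smul_neg, ← h, inv_smul_smul₀ hr]⟩
  let e : Fin n → ℝ := fun _ => 1
  have he : e ≠ 0 := fun h => one_ne_zero (congrFun h ⟨0, by omega⟩)
  rcases hirr (ℝ ∙ e) fun A hA x hx => by
    obtain ⟨c, rfl⟩ := hscalar A hA
    rw [smul_mulVec, one_mulVec]
    exact Submodule.smul_mem _ c hx with h | h
  · exact he (Submodule.span_singleton_eq_bot.mp h)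
  · have hrank := finrank_span_singleton (K := ℝ) he
    rw [h, finrank_top, Module.finrank_fin_fun] at hrank
    omega
end

section
/- Let n ≥ 2 and let S be an irreducible semigroup of matrices in M_n(ℂ) all of whose eigenvalues are real, and suppose S is topologically closed and closed under multiplication by real scalars (equivalently, S equals the topological closure of ℝ·S). Then S contains a nonzero singular matrix, i.e., there exists A ∈ S with A ≠ 0 and A not invertible. -/
section

open scoped Matrix.Norms.Operator

namespace Matrix

variable {m : Type*} [Fintype m] [DecidableEq m]

theorem norm_le_one_of_mem_spectrum_of_norm_pow_le {A : Matrix m m ℂ} {C : ℝ}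
    (hA : ∀ k : ℕ, ‖A ^ (k + 1)‖ ≤ C) {z : ℂ} (hz : z ∈ spectrum ℂ A) : ‖z‖ ≤ 1 := by
  by_contra! h
  obtain ⟨k, hk⟩ := pow_unbounded_of_one_lt (C * ‖(1 : Matrix m m ℂ)‖) h
  have h1 : ‖z ^ (k + 1)‖ ≤ ‖A ^ (k + 1)‖ * ‖(1 : Matrix m m ℂ)‖ :=
    spectrum.norm_le_norm_mul_of_mem (spectrum.pow_mem_pow A (k + 1) hz)
  have h2 : ‖A ^ (k + 1)‖ * ‖(1 : Matrix m m ℂ)‖ ≤ C * ‖(1 : Matrix m m ℂ)‖ := by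
    gcongr
    exact hA k
  have h3 : ‖z‖ ^ k ≤ ‖z‖ ^ (k + 1) := pow_le_pow_right₀ h.le k.le_succ
  rw [norm_pow] at h1
  linarith

theorem norm_eq_one_of_mem_spectrum {A : Matrix m m ℂ}
    (hA : ∀ z ∈ spectrum ℂ A, ‖z‖ ≤ 1) (hdet : ‖A.det‖ = 1) {z : ℂ}
    (hz : z ∈ spectrum ℂ A) : ‖z‖ = 1 := by
  have prod_le (s : Multiset ℂ) : (∀ x ∈ s, ‖x‖ ≤ 1) → ‖s.prod‖ ≤ 1 := by
    induction s using Multiset.induction_on with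
    | empty => simp
    | cons a s ih =>
      intro hs
      rw [Multiset.prod_cons, norm_mul]
      exact mul_le_one₀ (hs a (Multiset.mem_cons_self a s)) (norm_nonneg _)
        (ih fun x hx => hs x (Multiset.mem_cons_of_mem hx))
  have mem_iff (x : ℂ) : x ∈ A.charpoly.roots ↔ x ∈ spectrum ℂ A := by
    rw [Polynomial.mem_roots A.charpoly_monic.ne_zero, mem_spectrum_iff_isRoot_charpoly]
  have hprod := Multiset.prod_erase ((mem_iff z).2 hz)
  rw [← det_eq_prod_roots_charpoly] at hprod
  have hle := prod_le (A.charpoly.roots.erase z)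
    fun x hx => hA x ((mem_iff x).1 (Multiset.mem_of_mem_erase hx))
  rw [← hprod, norm_mul] at hdet
  nlinarith [hA z hz, norm_nonneg z]

theorem isNilpotent_of_spectrum_subset_zero {A : Matrix m m ℂ}
    (hA : ∀ z ∈ spectrum ℂ A, z = 0) : IsNilpotent A := by
  have hroots : A.charpoly.roots = Multiset.replicate A.charpoly.roots.card 0 :=
    Multiset.eq_replicate_card.2 fun x hx =>
      hA x (mem_spectrum_of_isRoot_charpoly (Polynomial.isRoot_of_mem_roots hx))
  have hpoly := (IsAlgClosed.splits A.charpoly).eq_prod_roots_of_monic A.charpoly_monic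
  rw [hroots] at hpoly
  refine ⟨A.charpoly.roots.card, ?_⟩
  have := A.aeval_self_charpoly
  rw [hpoly] at this
  simpa using this

theorem eq_zero_of_isNilpotent_of_norm_pow_le {N : Matrix m m ℂ} (hN : IsNilpotent N) {C : ℝ}
    (hC : ∀ k : ℕ, ‖(1 + N) ^ (k + 1)‖ ≤ C) : N = 0 := by
  by_contra hN0
  have hM : ∃ M : Matrix m m ℂ, N * M ≠ 0 ∧ N * (N * M) = 0 := by
    have hex : ∃ k, N ^ (k + 1) = 0 := by
      obtain ⟨k, hk⟩ := hN
      exact ⟨k, by rw [pow_succ, hk, zero_mul]⟩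
    classical
    obtain ⟨k, hk⟩ : ∃ k, Nat.find hex = k + 1 := by
      refine Nat.exists_eq_succ_of_ne_zero fun h0 => hN0 ?_
      have := Nat.find_spec hex
      rwa [h0, zero_add, pow_one] at this
    refine ⟨N ^ k, ?_, ?_⟩
    · rw [← pow_succ']
      exact Nat.find_min hex (by omega)
    · rw [← pow_succ', ← pow_succ', ← hk]
      exact Nat.find_spec hex
  obtain ⟨M, hNM, hNNM⟩ := hM
  have hpow (k : ℕ) : (1 + N) ^ k * M = M + (k : ℝ) • (N * M) := by
    induction k with
    | zero => simp
    | succ k ih =>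
      rw [pow_succ', mul_assoc, ih, add_mul, one_mul, mul_add, mul_smul_comm, hNNM]
      push_cast
      module
  have hpos : 0 < ‖N * M‖ := norm_pos_iff.2 hNM
  obtain ⟨k, hk⟩ := exists_nat_gt ((C * ‖M‖ + ‖M‖) / ‖N * M‖)
  rw [div_lt_iff₀ hpos] at hk
  have h1 : ((k + 1 : ℕ) : ℝ) * ‖N * M‖ ≤ C * ‖M‖ + ‖M‖ := by
    calc ((k + 1 : ℕ) : ℝ) * ‖N * M‖ = ‖((k + 1 : ℕ) : ℝ) • (N * M)‖ := by
          rw [norm_smul, Real.norm_natCast]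
      _ = ‖(1 + N) ^ (k + 1) * M - M‖ := by rw [hpow]; congr 1; abel
      _ ≤ ‖(1 + N) ^ (k + 1) * M‖ + ‖M‖ := norm_sub_le _ _
      _ ≤ C * ‖M‖ + ‖M‖ := by
          gcongr
          exact (norm_mul_le _ _).trans (by gcongr; exact hC k)
  push_cast at h1
  linarith

theorem sq_eq_one_of_norm_pow_le_of_real_spectrum {A : Matrix m m ℂ} {C : ℝ}
    (hA : ∀ k : ℕ, ‖A ^ (k + 1)‖ ≤ C) (hdet : ‖A.det‖ = 1)
    (hreal : ∀ z ∈ spectrum ℂ A, z.im = 0) : A ^ 2 = 1 := by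
  have hspec : ∀ z ∈ spectrum ℂ (A ^ 2), z = 1 := by
    rw [spectrum.map_pow_of_pos (𝕜 := ℂ) A two_pos]
    rintro _ ⟨z, hz, rfl⟩
    have hnorm := norm_eq_one_of_mem_spectrum
      (fun w hw => norm_le_one_of_mem_spectrum_of_norm_pow_le hA hw) hdet hz
    have hsq := Complex.sq_norm z
    rw [hnorm, Complex.normSq_apply, hreal z hz] at hsq
    apply Complex.ext <;> simp [pow_two, hreal z hz]
    linarith
  have hnil : IsNilpotent (A ^ 2 - 1) := by
    refine isNilpotent_of_spectrum_subset_zero fun z hz => ?_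
    have h : z + 1 ∈ spectrum ℂ (A ^ 2) := by
      rw [spectrum.mem_iff] at hz ⊢
      convert hz using 2
      rw [map_add, map_one]
      abel
    simpa using hspec _ h
  refine sub_eq_zero.1 (eq_zero_of_isNilpotent_of_norm_pow_le hnil (C := C) fun k => ?_)
  rw [add_sub_cancel, ← pow_mul]
  exact hA (2 * k + 1)

theorem exists_norm_le_of_isUnit_of_isClosed {S : Set (Matrix m m ℂ)} (hclosed : IsClosed S)
    (hscal : ∀ (r : ℝ), ∀ A ∈ S, r • A ∈ S) (hunit : ∀ A ∈ S, A ≠ 0 → IsUnit A) :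
    ∃ C : ℝ, ∀ A ∈ S, ‖A.det‖ = 1 → ‖A‖ ≤ C := by
  have hK : IsCompact (S ∩ Metric.sphere 0 1) := (isCompact_sphere 0 1).inter_left hclosed
  have hcont : ContinuousOn (fun A : Matrix m m ℂ => ‖A.det‖⁻¹) (S ∩ Metric.sphere 0 1) := by
    refine ContinuousOn.inv₀ (continuous_id.matrix_det.norm.continuousOn) fun A hA => ?_
    have hA0 : A ≠ 0 := ne_zero_of_mem_unit_sphere ⟨A, hA.2⟩
    exact norm_ne_zero_iff.2 ((isUnit_iff_isUnit_det A).1 (hunit A hA.1 hA0)).ne_zero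
  obtain ⟨c, hc⟩ := hK.bddAbove_image hcont
  refine ⟨max 1 c, fun A hA hdet => ?_⟩
  by_contra! hlt
  obtain ⟨h1, hcA⟩ := max_lt_iff.1 hlt
  have hpos : 0 < ‖A‖ := by linarith
  have hmem : ‖A‖⁻¹ • A ∈ S ∩ Metric.sphere 0 1 :=
    ⟨hscal _ A hA, by simp [norm_smul, hpos.ne']⟩
  have hle := hc (Set.mem_image_of_mem _ hmem)
  have hd : ‖(‖A‖⁻¹ • A).det‖⁻¹ = ‖A‖ ^ Fintype.card m := by
    rw [← Complex.coe_smul, det_smul, norm_mul, hdet]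
    simp
  have hcard : Fintype.card m ≠ 0 := by
    intro h0
    have := Fintype.card_eq_zero_iff.1 h0
    rw [Subsingleton.elim A 0, norm_zero] at hpos
    exact lt_irrefl _ hpos
  rw [hd] at hle
  linarith [le_self_pow₀ h1.le hcard]

theorem mul_comm_of_isUnit_of_real_spectrum {S : Set (Matrix m m ℂ)}
    (hmul : ∀ A ∈ S, ∀ B ∈ S, A * B ∈ S)
    (hspec : ∀ A ∈ S, ∀ z ∈ spectrum ℂ A, z.im = 0) (hclosed : IsClosed S)
    (hscal : ∀ (r : ℝ), ∀ A ∈ S, r • A ∈ S) (hunit : ∀ A ∈ S, A ≠ 0 → IsUnit A) :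
    ∀ A ∈ S, ∀ B ∈ S, A * B = B * A := by
  obtain ⟨C, hC⟩ := exists_norm_le_of_isUnit_of_isClosed hclosed hscal hunit
  have hsq : ∀ A ∈ S, ‖A.det‖ = 1 → A ^ 2 = 1 := fun A hA hdet => by
    have hpow (k : ℕ) : A ^ (k + 1) ∈ S := by
      induction k with
      | zero => simpa using hA
      | succ k ih => rw [pow_succ]; exact hmul _ ih _ hA
    exact sq_eq_one_of_norm_pow_le_of_real_spectrum
      (fun k => hC _ (hpow k) (by simp [hdet])) hdet (hspec A hA)
  have hcomm : ∀ A ∈ S, ∀ B ∈ S, ‖A.det‖ = 1 → ‖B.det‖ = 1 → A * B = B * A := by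
    intro A hA B hB hdA hdB
    have h1 := hsq A hA hdA
    have h2 := hsq B hB hdB
    have h3 := hsq (A * B) (hmul A hA B hB) (by rw [det_mul, norm_mul, hdA, hdB, one_mul])
    rw [pow_two] at h1 h2 h3
    calc A * B = A * ((A * B) * (A * B)) * B := by rw [h3, mul_one]
      _ = (A * A) * (B * A) * (B * B) := by simp only [mul_assoc]
      _ = B * A := by rw [h1, h2, one_mul, mul_one]
  have hnormalize : ∀ A ∈ S, A ≠ 0 → ∃ r : ℝ, r ≠ 0 ∧ ‖(r • A).det‖ = 1 := by
    intro A hA hA0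
    have hd : 0 < ‖A.det‖ :=
      norm_pos_iff.2 ((isUnit_iff_isUnit_det A).1 (hunit A hA hA0)).ne_zero
    have hcard : Fintype.card m ≠ 0 := fun h0 => by
      have := Fintype.card_eq_zero_iff.1 h0
      exact hA0 (Subsingleton.elim A 0)
    refine ⟨(‖A.det‖⁻¹) ^ ((Fintype.card m : ℝ)⁻¹), (by positivity), ?_⟩
    rw [← Complex.coe_smul, det_smul, norm_mul, norm_pow, Complex.norm_real, Real.norm_eq_abs,
      abs_of_pos (by positivity), Real.rpow_inv_natCast_pow (by positivity) hcard,
      inv_mul_cancel₀ hd.ne']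
  intro A hA B hB
  by_cases hA0 : A = 0
  · simp [hA0]
  by_cases hB0 : B = 0
  · simp [hB0]
  obtain ⟨r, hr, hrA⟩ := hnormalize A hA hA0
  obtain ⟨s, hs, hsB⟩ := hnormalize B hB hB0
  have h := hcomm _ (hscal r A hA) _ (hscal s B hB) hrA hsB
  rw [smul_mul_smul_comm, smul_mul_smul_comm, mul_comm s r] at h
  exact smul_right_injective _ (mul_ne_zero hr hs) h

theorem exists_invariant_submodule_of_commute [Nontrivial m] {S : Set (Matrix m m ℂ)}
    (hcomm : ∀ A ∈ S, ∀ B ∈ S, A * B = B * A) :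
    ∃ W : Submodule ℂ (m → ℂ), (∀ A ∈ S, ∀ x ∈ W, A.mulVec x ∈ W) ∧ W ≠ ⊥ ∧ W ≠ ⊤ := by
  by_contra! hirr
  have hscalar : ∀ A ∈ S, ∃ z : ℂ, ∀ x, A.mulVec x = z • x := by
    intro A hA
    obtain ⟨z, hz⟩ := Module.End.exists_eigenvalue (toLin' A)
    refine ⟨z, fun x => ?_⟩
    have htop := hirr (Module.End.eigenspace (toLin' A) z) (fun B hB x hx => ?_) hz
    · have hx : x ∈ Module.End.eigenspace (toLin' A) z := htop ▸ Submodule.mem_top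
      simpa [Module.End.mem_eigenspace_iff] using hx
    · rw [Module.End.mem_eigenspace_iff, toLin'_apply] at hx ⊢
      rw [mulVec_mulVec, hcomm A hA B hB, ← mulVec_mulVec, hx, mulVec_smul]
  obtain ⟨i, j, hij⟩ := exists_pair_ne m
  have htop := hirr (Submodule.span ℂ {Pi.single i 1}) (fun A hA x hx => ?_) ?_
  · have hmem : Pi.single j 1 ∈ Submodule.span ℂ {(Pi.single i 1 : m → ℂ)} :=
      htop ▸ Submodule.mem_top
    obtain ⟨c, hc⟩ := Submodule.mem_span_singleton.1 hmem
    simpa [hij.symm] using congrFun hc j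
  · obtain ⟨z, hz⟩ := hscalar A hA
    rw [hz]
    exact Submodule.smul_mem _ _ hx
  · rw [Ne, Submodule.span_singleton_eq_bot]
    simp

end Matrix

end

/-- An irreducible semigroup of matrices in `Mₙ(ℂ)` (`n ≥ 2`) with real spectra
that is topologically closed and closed under multiplication by real scalars contains a
nonzero singular matrix. -/
theorem complex_irreducible_closed_semigroup_real_spectra_contains_nonzero_singular
    (n : ℕ) (hn : 2 ≤ n) (S : Set (Matrix (Fin n) (Fin n) ℂ))
    -- `S` is a multiplicative semigroup
    (hmul : ∀ A ∈ S, ∀ B ∈ S, A * B ∈ S)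
    -- every eigenvalue of every member of `S` is real
    (hspec : ∀ A ∈ S, ∀ μ ∈ spectrum ℂ A, μ.im = 0)
    -- `S` is irreducible
    (hne : S ≠ {0})
    (hirr : ∀ W : Submodule ℂ (Fin n → ℂ),
      (∀ A ∈ S, ∀ x ∈ W, A.mulVec x ∈ W) → W = ⊥ ∨ W = ⊤)
    -- `S` is topologically closed and closed under real scalar multiplication
    (hclosed : IsClosed S)
    (hscal : ∀ (r : ℝ), ∀ A ∈ S, r • A ∈ S) :
    ∃ A ∈ S, A ≠ 0 ∧ ¬ IsUnit A := by
  by_contra! hunit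
  have hcomm := Matrix.mul_comm_of_isUnit_of_real_spectrum hmul hspec hclosed hscal hunit
  have : Nontrivial (Fin n) := Fin.nontrivial_iff_two_le.2 hn
  obtain ⟨W, hW, hbot, htop⟩ := Matrix.exists_invariant_submodule_of_commute hcomm
  exact (hirr W hW).elim hbot htop
end

section
/- Let n ≥ 1 and let A be an irreducible ℝ-subalgebra of M_n(ℝ), and let r be the smallest nonzero rank of a matrix in A. Then r divides n, r ∈ {1, 2, 4}, and: if r = 1 then A = M_n(ℝ); if r = 2 then there is an invertible P ∈ M_n(ℝ) with P⁻¹AP = ε_{n/2}(M_{n/2}(ℂ)); if r = 4 then there is an invertible P ∈ M_n(ℝ) with P⁻¹AP = ε''_{n/4}(M_{n/4}(ℍ)). In particular, A = M_n(ℝ) if and only if r = 1. -/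
/-- The standard representation `ε : ℂ → M₂(ℝ)`, sending `a + bi` to `[[a, -b], [b, a]]`. -/
noncomputable def epsC (z : ℂ) : Matrix (Fin 2) (Fin 2) ℝ := !![z.re, -z.im; z.im, z.re]

/-- `ε_m : M_m(ℂ) → M_{2m}(ℝ)`, applying `ε` entrywise in 2×2 blocks. -/
noncomputable def epsCMat (m : ℕ) (A : Matrix (Fin m) (Fin m) ℂ) :
    Matrix (Fin (2 * m)) (Fin (2 * m)) ℝ :=
  fun i j => epsC (A ⟨i.val / 2, by omega⟩ ⟨j.val / 2, by omega⟩)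
    ⟨i.val % 2, by omega⟩ ⟨j.val % 2, by omega⟩

/-- The standard representation `ε'' : ℍ → M₄(ℝ)`. -/
noncomputable def epsH (q : Quaternion ℝ) : Matrix (Fin 4) (Fin 4) ℝ :=
  !![q.re, -q.imI, q.imJ, -q.imK;
     q.imI, q.re, q.imK, q.imJ;
     -q.imJ, -q.imK, q.re, q.imI;
     q.imK, -q.imJ, -q.imI, q.re]

/-- `ε''_m : M_m(ℍ) → M_{4m}(ℝ)`, applying `ε''` entrywise in 4×4 blocks. -/
noncomputable def epsHMat (m : ℕ) (A : Matrix (Fin m) (Fin m) (Quaternion ℝ)) :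
    Matrix (Fin (4 * m)) (Fin (4 * m)) ℝ :=
  fun i j => epsH (A ⟨i.val / 4, by omega⟩ ⟨j.val / 4, by omega⟩)
    ⟨i.val % 4, by omega⟩ ⟨j.val % 4, by omega⟩

section Frobenius

variable {D : Type*} [DivisionRing D] [Algebra ℝ D]

/-- An element of a finite-dimensional real division algebra is real or lies in a copy of `ℂ`. -/
theorem exists_real_or_exists_imaginary_unit [FiniteDimensional ℝ D] (x : D) :
    (∃ a : ℝ, x = algebraMap ℝ D a) ∨
      ∃ a b : ℝ, ∃ u : D, b ≠ 0 ∧ u * u = -1 ∧ x = algebraMap ℝ D a + b • u := by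
  have hx : IsIntegral ℝ x := Algebra.IsIntegral.isIntegral x
  have hquad := Polynomial.eq_quadratic_of_degree_le_two (minpoly.irreducible hx).degree_le_two
  set a := (minpoly ℝ x).coeff 2
  set b := (minpoly ℝ x).coeff 1
  set c := (minpoly ℝ x).coeff 0
  have heval : a • (x * x) + b • x + algebraMap ℝ D c = 0 := by
    have h := minpoly.aeval ℝ x
    rw [hquad] at h
    simpa [Algebra.smul_def, pow_two] using h
  by_cases ha : a = 0
  · by_cases hb : b = 0
    · have hc : c = 0 := by simpa [ha, hb] using heval
      exact absurd (by rw [hquad]; simp [ha, hb, hc]) (minpoly.ne_zero hx)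
    · refine Or.inl ⟨-(b⁻¹ * c), ?_⟩
      have h : b • x = algebraMap ℝ D (-c) := by
        rw [map_neg]
        exact eq_neg_of_add_eq_zero_left (by simpa [ha] using heval)
      calc x = b⁻¹ • b • x := by rw [smul_smul, inv_mul_cancel₀ hb, one_smul]
        _ = _ := by rw [h, Algebra.smul_def, ← map_mul]; ring_nf
  · set p := b / (2 * a) with hp
    set d := c / a - p * p with hd
    set y := x + algebraMap ℝ D p with hy
    have hxy : x = algebraMap ℝ D (-p) + y := by rw [hy, map_neg]; abel
    have hcomm : x * algebraMap ℝ D p = algebraMap ℝ D p * x := (Algebra.commutes p x).symm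
    have hyy : y * y = algebraMap ℝ D (-d) := by
      have h2 : a⁻¹ • (a • (x * x) + b • x + algebraMap ℝ D c) = 0 := by rw [heval, smul_zero]
      have h3 : x * x = - ((2 * p) • x) - algebraMap ℝ D (c / a) := by
        rw [smul_add, smul_add, smul_smul, inv_mul_cancel₀ ha, one_smul, smul_smul,
          Algebra.smul_def _ (algebraMap ℝ D c), ← map_mul] at h2
        have e1 : a⁻¹ * b = 2 * p := by rw [hp]; field_simp
        have e2 : a⁻¹ * c = c / a := by field_simp
        rw [e1, e2] at h2
        linear_combination (norm := module) h2
      rw [hy, mul_add, add_mul, add_mul, h3, hcomm, hd, ← map_mul, Algebra.smul_def]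
      simp only [map_neg, map_sub, map_mul, map_ofNat]
      noncomm_ring
    by_cases hd0 : d ≤ 0
    · refine Or.inl ?_
      have hs : y * y = algebraMap ℝ D (Real.sqrt (-d)) * algebraMap ℝ D (Real.sqrt (-d)) := by
        rw [hyy, ← map_mul, Real.mul_self_sqrt (by linarith)]
      rcases (show Commute y _ from
        (Algebra.commutes (Real.sqrt (-d)) y).symm).mul_self_eq_mul_self_iff.mp hs with h | h
      · exact ⟨-p + Real.sqrt (-d), by rw [hxy, h, map_add]⟩
      · exact ⟨-p - Real.sqrt (-d), by rw [hxy, h, map_sub]; abel⟩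
    · have hpos : 0 < Real.sqrt d := Real.sqrt_pos.mpr (by linarith)
      refine Or.inr ⟨-p, Real.sqrt d, (Real.sqrt d)⁻¹ • y, hpos.ne', ?_, ?_⟩
      · rw [smul_mul_smul_comm, hyy, Algebra.smul_def, ← map_mul, ← mul_inv,
          Real.mul_self_sqrt (by linarith), mul_neg, inv_mul_cancel₀ (by linarith), map_neg, map_one]
      · rw [smul_smul, mul_inv_cancel₀ hpos.ne', one_smul, hxy]

/-- An element commuting with an imaginary unit `i` lies in `ℝ + ℝ i`. -/
theorem exists_eq_add_smul_of_commute [FiniteDimensional ℝ D] {i x : D} (hi : i * i = -1)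
    (hx : Commute i x) : ∃ a b : ℝ, x = algebraMap ℝ D a + b • i := by
  rcases exists_real_or_exists_imaginary_unit x with ⟨a, rfl⟩ | ⟨a, b, u, hb, hu, rfl⟩
  · exact ⟨a, 0, by simp⟩
  · have hiu : Commute i u := by
      have h : Commute i (b • u) := by
        simpa using hx.sub_right (Algebra.commutes a i).symm
      simpa [smul_smul, inv_mul_cancel₀ hb] using h.smul_right b⁻¹
    rcases hiu.symm.mul_self_eq_mul_self_iff.mp (hu.trans hi.symm) with rfl | rfl
    · exact ⟨a, b, rfl⟩
    · exact ⟨a, -b, by simp⟩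

/-- **Frobenius' theorem**: a finite-dimensional real division algebra is a quotient (hence a copy)
of `ℝ`, `ℂ` or `ℍ`. -/
theorem exists_surjective_algHom_of_finiteDimensional [FiniteDimensional ℝ D] :
    (∃ f : ℝ →ₐ[ℝ] D, Function.Surjective f) ∨ (∃ f : ℂ →ₐ[ℝ] D, Function.Surjective f) ∨
      ∃ f : Quaternion ℝ →ₐ[ℝ] D, Function.Surjective f := by
  by_cases hreal : ∀ x : D, ∃ a : ℝ, x = algebraMap ℝ D a
  · exact Or.inl ⟨Algebra.ofId ℝ D, fun x => (hreal x).imp fun a h => h.symm⟩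
  right
  obtain ⟨i, hi⟩ : ∃ i : D, i * i = -1 := by
    push Not at hreal
    obtain ⟨x, hx⟩ := hreal
    rcases exists_real_or_exists_imaginary_unit x with ⟨a, h⟩ | ⟨-, -, u, -, hu, -⟩
    · exact absurd h (hx a)
    · exact ⟨u, hu⟩
  have hi0 : i ≠ 0 := by rintro rfl; simp at hi
  by_cases hcomm : ∀ x : D, Commute i x
  · refine Or.inl ⟨Complex.liftAux i hi, fun x => ?_⟩
    obtain ⟨a, b, rfl⟩ := exists_eq_add_smul_of_commute hi (hcomm x)
    exact ⟨⟨a, b⟩, by simp [Complex.liftAux_apply]⟩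
  right
  have htwo : ∀ x : D, x + x = 0 → x = 0 := fun x h => by
    have : (2 : ℝ) • x = 0 := by rw [two_smul, h]
    simpa using this
  have hii : ∀ z : D, i * (i * z) = -z := fun z => by rw [← mul_assoc, hi, neg_one_mul]
  have hplus : ∀ x : D, Commute i (x - i * x * i) := fun x => by
    simp only [Commute, SemiconjBy, mul_sub, sub_mul, mul_assoc, hi, hii]
    simp [add_comm]
  have hminus : ∀ x : D, i * (x + i * x * i) = -((x + i * x * i) * i) := fun x => by
    simp only [mul_add, add_mul, mul_assoc, hi, hii]
    simp
  have hsum : ∀ x : D, x = (2⁻¹ : ℝ) • (x - i * x * i) + (2⁻¹ : ℝ) • (x + i * x * i) := fun x => by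
    rw [← smul_add, sub_add_add_cancel, ← two_smul ℝ x, smul_smul]
    norm_num
  obtain ⟨y, hy0, hy⟩ : ∃ y : D, y ≠ 0 ∧ i * y = -(y * i) := by
    push Not at hcomm
    obtain ⟨x, hx⟩ := hcomm
    refine ⟨x + i * x * i, fun h0 => hx ?_, hminus x⟩
    have h := (hplus x).smul_right (2⁻¹ : ℝ)
    rwa [show (2⁻¹ : ℝ) • (x - i * x * i) = x by
      conv_rhs => rw [hsum x, h0, smul_zero, add_zero]] at h
  obtain ⟨j, hj, hij⟩ : ∃ j : D, j * j = -1 ∧ i * j = -(j * i) := by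
    have hyyi : Commute i (y * y) := by
      rw [Commute, SemiconjBy, ← mul_assoc, hy, neg_mul, mul_assoc, hy, mul_neg, neg_neg, mul_assoc]
    have hyy : ∃ a : ℝ, y * y = algebraMap ℝ D a := by
      obtain ⟨a, b, hab⟩ := exists_eq_add_smul_of_commute hi hyyi
      have h1 : y * (y * y) = y * y * y := (mul_assoc _ _ _).symm
      rw [hab, mul_add, add_mul, ← Algebra.commutes a y, mul_smul_comm, smul_mul_assoc, hy,
        smul_neg] at h1
      have h2 := htwo _ (eq_neg_iff_add_eq_zero.mp (add_left_cancel h1))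
      have hb : b = 0 := (smul_eq_zero.mp h2).resolve_right (mul_ne_zero hy0 hi0)
      exact ⟨a, by rw [hab, hb, zero_smul, add_zero]⟩
    obtain ⟨a, ha⟩ := hyy
    have hnotreal : ∀ t : ℝ, y ≠ algebraMap ℝ D t := by
      rintro t rfl
      rw [← Algebra.commutes t i] at hy
      exact (mul_ne_zero hy0 hi0) (by
        rw [Algebra.commutes]
        exact htwo _ (eq_neg_iff_add_eq_zero.mp (by rwa [Algebra.commutes] at hy)))
    rcases le_or_gt 0 a with h0 | h0
    · have hs : y * y = algebraMap ℝ D (Real.sqrt a) * algebraMap ℝ D (Real.sqrt a) := by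
        rw [ha, ← map_mul, Real.mul_self_sqrt h0]
      rcases (show Commute y _ from
        (Algebra.commutes (Real.sqrt a) y).symm).mul_self_eq_mul_self_iff.mp hs with h | h
      · exact absurd h (hnotreal _)
      · exact absurd (by rw [h, map_neg]) (hnotreal (-Real.sqrt a))
    · refine ⟨(Real.sqrt (-a))⁻¹ • y, ?_, by rw [mul_smul_comm, hy, smul_mul_assoc, smul_neg]⟩
      rw [smul_mul_smul_comm, ha, Algebra.smul_def, ← map_mul, ← mul_inv,
        Real.mul_self_sqrt (by linarith), ← neg_neg a, neg_neg (-a), mul_neg,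
        inv_mul_cancel₀ (by linarith), map_neg, map_one]
  let q : QuaternionAlgebra.Basis D (-1 : ℝ) 0 (-1) :=
    { i := i, j := j, k := i * j
      i_mul_i := by simp [hi]
      j_mul_j := by simp [hj]
      i_mul_j := rfl
      j_mul_i := by simp [hij] }
  refine ⟨q.liftHom, fun x => ?_⟩
  obtain ⟨a, b, hab⟩ := exists_eq_add_smul_of_commute hi ((hplus x).smul_right (2⁻¹ : ℝ))
  set w := (2⁻¹ : ℝ) • (x + i * x * i) with hw
  have hiw : i * w = -(w * i) := by
    rw [hw, mul_smul_comm, hminus, smul_neg, smul_mul_assoc]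
  have hwj : Commute i (w * j) := by
    rw [Commute, SemiconjBy, ← mul_assoc, hiw, neg_mul, mul_assoc, hij, mul_neg, neg_neg, mul_assoc]
  obtain ⟨c, d, hcd⟩ := exists_eq_add_smul_of_commute hi hwj
  have hwcd : w = (-c) • j + (-d) • (i * j) := by
    have h : w * j * j = (algebraMap ℝ D c + d • i) * j := by rw [hcd]
    rw [mul_assoc, hj, mul_neg_one, add_mul, ← Algebra.smul_def, smul_mul_assoc] at h
    rw [← neg_neg w, h, neg_add, neg_smul, neg_smul]
  refine ⟨⟨a, b, -c, -d⟩, ?_⟩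
  rw [hsum x, hab, ← hw, hwcd]
  change q.lift ⟨a, b, -c, -d⟩ = _
  simp [QuaternionAlgebra.Basis.lift, q, add_assoc]

end Frobenius

section DoubleCentralizer

variable {k V : Type*} [Field k] [AddCommGroup V] [Module k V]

/-- The unital hull of a non-unital algebra of operators absorbs it on the left. -/
theorem mul_mem_of_mem_adjoin {A : NonUnitalSubalgebra k (Module.End k V)} {r a : Module.End k V}
    (hr : r ∈ Algebra.adjoin k (A : Set (Module.End k V))) (ha : a ∈ A) : r * a ∈ A := by
  induction hr using Algebra.adjoin_induction generalizing a with
  | mem x hx => exact A.mul_mem hx ha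
  | algebraMap c => rw [← Algebra.smul_def]; exact SMulMemClass.smul_mem c ha
  | add x y _ _ hx hy => rw [add_mul]; exact A.add_mem (hx ha) (hy ha)
  | mul x y _ _ hx hy => rw [mul_assoc]; exact hx (hy ha)

/-- The unital hull of an irreducible algebra of operators acts irreducibly. -/
theorem isSimpleModule_adjoin [Nontrivial V] {A : NonUnitalSubalgebra k (Module.End k V)}
    (hirr : ∀ W : Submodule k V, (∀ a ∈ A, ∀ x ∈ W, a x ∈ W) → W = ⊥ ∨ W = ⊤) :
    IsSimpleModule (Algebra.adjoin k (A : Set (Module.End k V))) V := by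
  rw [isSimpleModule_iff]
  refine { eq_bot_or_eq_top := fun W => ?_ }
  have hW := hirr (W.restrictScalars k) fun a ha x hx =>
    W.smul_mem (⟨a, Algebra.subset_adjoin ha⟩ : Algebra.adjoin k (A : Set (Module.End k V))) hx
  simpa using hW

/-- An irreducible algebra of operators on a finite-dimensional space contains the identity. -/
theorem one_mem_of_irreducible [FiniteDimensional k V] [Nontrivial V]
    {A : NonUnitalSubalgebra k (Module.End k V)} (hne : ∃ a ∈ A, a ≠ 0)
    (hirr : ∀ W : Submodule k V, (∀ a ∈ A, ∀ x ∈ W, a x ∈ W) → W = ⊥ ∨ W = ⊤) :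
    (1 : Module.End k V) ∈ A := by
  set R := Algebra.adjoin k (A : Set (Module.End k V))
  have : IsSimpleModule R V := isSimpleModule_adjoin hirr
  let b := Module.finBasis k V
  let x : Fin (Module.finrank k V) → V := b
  -- the orbit of the basis under `A`, as an `R`-submodule
  let N : Submodule R (Fin (Module.finrank k V) → V) :=
    { carrier := {y | ∃ a ∈ A, ∀ i, y i = a (x i)}
      zero_mem' := ⟨0, A.zero_mem, fun i => rfl⟩
      add_mem' := by
        rintro y z ⟨a, ha, hy⟩ ⟨c, hc, hz⟩
        exact ⟨a + c, A.add_mem ha hc, fun i => by simp [hy, hz]⟩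
      smul_mem' := by
        rintro r y ⟨a, ha, hy⟩
        exact ⟨r * a, mul_mem_of_mem_adjoin r.2 ha, fun i => by
          simp [hy, Subalgebra.smul_def]⟩ }
  obtain ⟨C, hC⟩ := exists_isCompl N
  have hker : ∀ v : V, (∀ a ∈ A, a v = 0) → v = 0 := by
    let K : Submodule k V :=
      { carrier := {v | ∀ a ∈ A, a v = 0}
        zero_mem' := fun a _ => map_zero a
        add_mem' := fun hv hw a ha => by rw [map_add, hv a ha, hw a ha, add_zero]
        smul_mem' := fun c v hv a ha => by rw [map_smul, hv a ha, smul_zero] }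
    rcases hirr K fun a ha v hv c hc => by rw [hv a ha, map_zero] with h | h
    · exact fun v hv => (Submodule.mem_bot k).mp (h ▸ (show v ∈ K from hv))
    · obtain ⟨a, ha, ha0⟩ := hne
      refine absurd (LinearMap.ext fun v => ?_) ha0
      exact (show v ∈ K from h ▸ Submodule.mem_top) a ha
  obtain ⟨y, hy, c, hc, hyc⟩ := Submodule.mem_sup.mp
    (show x ∈ N ⊔ C by rw [hC.sup_eq_top]; exact Submodule.mem_top)
  have hc0 : c = 0 := by
    funext i
    refine hker _ fun a ha => ?_
    let r : R := ⟨a, Algebra.subset_adjoin ha⟩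
    have h1 : r • c ∈ C := C.smul_mem r hc
    have h2 : r • c ∈ N := by
      have : r • c = r • x - r • y := by rw [← hyc, smul_add, add_sub_cancel_left]
      rw [this]
      exact N.sub_mem ⟨a, ha, fun i => rfl⟩ (N.smul_mem r hy)
    exact congrFun ((Submodule.mem_bot R).mp (hC.inf_eq_bot ▸ Submodule.mem_inf.mpr ⟨h2, h1⟩)) i
  obtain ⟨a, ha, hya⟩ := hy
  have : a = 1 := b.ext fun i => by
    rw [← hya i]
    simpa [hc0] using congrFun hyc i
  exact this ▸ ha

/-- An irreducible algebra of operators on a finite-dimensional space is its own bicommutant. -/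
theorem mem_of_commute_of_irreducible [FiniteDimensional k V] [Nontrivial V]
    {A : NonUnitalSubalgebra k (Module.End k V)} (hne : ∃ a ∈ A, a ≠ 0)
    (hirr : ∀ W : Submodule k V, (∀ a ∈ A, ∀ x ∈ W, a x ∈ W) → W = ⊥ ∨ W = ⊤)
    {f : Module.End k V} (hf : ∀ g : Module.End (Algebra.adjoin k (A : Set (Module.End k V))) V,
      ∀ v, f (g v) = g (f v)) : f ∈ A := by
  have := isSimpleModule_adjoin hirr
  let F : Module.End (Module.End (Algebra.adjoin k (A : Set (Module.End k V))) V) V :=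
    { toFun := f, map_add' := map_add f, map_smul' := hf }
  let b := Module.finBasis k V
  classical
  obtain ⟨r, hr⟩ := jacobson_density F (Finset.univ.image b)
  have hfr : f = r := b.ext fun i => hr (b i) (by simp)
  rw [hfr, ← mul_one (r : Module.End k V)]
  exact mul_mem_of_mem_adjoin r.2 (one_mem_of_irreducible hne hirr)

theorem finiteDimensional_end_subalgebra [FiniteDimensional k V] (R : Subalgebra k (Module.End k V)) :
    FiniteDimensional k (Module.End R V) :=
  Module.Finite.of_injective (LinearMap.restrictScalarsₗ k R V V k)
    (LinearMap.restrictScalars_injective k)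

end DoubleCentralizer

section Blocks

open Matrix Module

/-- Replace each entry of an `m × m` matrix by the `d × d` real block assigned to it by `e`. -/
def blockMatrix {K : Type*} {d : ℕ} (m : ℕ) (e : K → Matrix (Fin d) (Fin d) ℝ)
    (C : Matrix (Fin m) (Fin m) K) : Matrix (Fin (d * m)) (Fin (d * m)) ℝ :=
  let σ : Fin (d * m) ≃ Fin d × Fin m :=
    (finCongr (mul_comm d m)).trans (finProdFinEquiv.symm.trans (Equiv.prodComm _ _))
  fun i j => e (C (σ i).2 (σ j).2) (σ i).1 (σ j).1

variable {K : Type*} [DivisionRing K] [Algebra ℝ K] {n d : ℕ} [Module K (Fin n → ℝ)]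
  [IsScalarTower ℝ K (Fin n → ℝ)]

/-- The operator of a matrix commuting with the `K`-action, as a `K`-linear map. -/
def Matrix.toLinOfCommute (X : Matrix (Fin n) (Fin n) ℝ)
    (hX : ∀ (c : K) v, X *ᵥ (c • v) = c • X *ᵥ v) : (Fin n → ℝ) →ₗ[K] (Fin n → ℝ) :=
  { toFun := X.mulVec, map_add' := X.mulVec_add, map_smul' := hX }

theorem rank_eq_of_commute [FiniteDimensional ℝ K] {X : Matrix (Fin n) (Fin n) ℝ}
    (hX : ∀ (c : K) v, X *ᵥ (c • v) = c • X *ᵥ v) :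
    X.rank = finrank ℝ K * finrank K (LinearMap.range (X.toLinOfCommute hX)) := by
  rw [finrank_mul_finrank]
  rfl

theorem mulVec_smul_toMatrix' (F : (Fin n → ℝ) →ₗ[K] (Fin n → ℝ)) (c : K) (v : Fin n → ℝ) :
    (LinearMap.toMatrix' (F.restrictScalars ℝ)) *ᵥ (c • v) =
      c • (LinearMap.toMatrix' (F.restrictScalars ℝ)) *ᵥ v := by
  simp [LinearMap.toMatrix'_mulVec]

/-- The minimal rank in the algebra of `K`-linear operators is the real dimension of `K`. -/
theorem finrank_eq_of_minimal_rank [FiniteDimensional ℝ K] (hn : 1 ≤ n)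
    {𝒜 : NonUnitalSubalgebra ℝ (Matrix (Fin n) (Fin n) ℝ)}
    (h𝒜 : ∀ X, X ∈ 𝒜 ↔ ∀ (c : K) v, X *ᵥ (c • v) = c • X *ᵥ v)
    {r : ℕ} (hr0 : r ≠ 0) (hrmem : ∃ A ∈ 𝒜, A.rank = r)
    (hrmin : ∀ A ∈ 𝒜, A.rank ≠ 0 → r ≤ A.rank) : r = finrank ℝ K := by
  have hd : 0 < finrank ℝ K := finrank_pos
  apply le_antisymm
  · have : Nonempty (Fin n) := ⟨⟨0, hn⟩⟩
    have : Module.Finite K (Fin n → ℝ) := Module.Finite.of_restrictScalars_finite ℝ K _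
    let b := finBasis K (Fin n → ℝ)
    let i : Fin (finrank K (Fin n → ℝ)) := ⟨0, finrank_pos⟩
    let F := (LinearMap.toSpanSingleton K (Fin n → ℝ) (b i)).comp (b.coord i)
    have hF : finrank K (LinearMap.range F) = 1 := by
      have hcoord : LinearMap.range (b.coord i) = ⊤ :=
        LinearMap.range_eq_top.mpr fun t => ⟨t • b i, by simp⟩
      rw [LinearMap.range_comp_of_range_eq_top _ hcoord, LinearMap.range_toSpanSingleton,
        finrank_span_singleton (b.ne_zero i)]
    have hcomm := mulVec_smul_toMatrix' F
    have hrank := rank_eq_of_commute hcomm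
    have htoLin : (LinearMap.toMatrix' (F.restrictScalars ℝ)).toLinOfCommute hcomm = F :=
      LinearMap.ext fun v => LinearMap.toMatrix'_mulVec (F.restrictScalars ℝ) v
    rw [htoLin, hF, mul_one] at hrank
    rw [← hrank]
    exact hrmin _ ((h𝒜 _).mpr hcomm) (by omega)
  · obtain ⟨A, hA, rfl⟩ := hrmem
    rw [rank_eq_of_commute ((h𝒜 A).mp hA)] at hr0 ⊢
    exact Nat.le_mul_of_pos_right _ (Nat.pos_of_ne_zero (right_ne_zero_of_mul hr0))

/-- The algebra of `K`-linear operators is conjugate to the algebra of matrices over `K`, embedded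
by blocks `e` representing right multiplication in a real basis of `K`. -/
theorem exists_conj_eq_range_blockMatrix
    {𝒜 : NonUnitalSubalgebra ℝ (Matrix (Fin n) (Fin n) ℝ)}
    (h𝒜 : ∀ X, X ∈ 𝒜 ↔ ∀ (c : K) v, X *ᵥ (c • v) = c • X *ᵥ v)
    (b : Basis (Fin d) ℝ K) (τ : K ≃ K) (e : K → Matrix (Fin d) (Fin d) ℝ)
    (he : ∀ c k l, b.repr (b l * c) k = e (τ c) k l) :
    ∃ m : ℕ, ∃ h : n = d * m, ∃ P : (Matrix (Fin n) (Fin n) ℝ)ˣ,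
      (fun X => (P⁻¹).val * X * P.val) '' (𝒜 : Set (Matrix (Fin n) (Fin n) ℝ)) =
        Set.range (fun C : Matrix (Fin m) (Fin m) K =>
          Matrix.reindex (finCongr h.symm) (finCongr h.symm) (blockMatrix m e C)) := by
  have : Module.Finite K (Fin n → ℝ) := Module.Finite.of_restrictScalars_finite ℝ K _
  let m := finrank K (Fin n → ℝ)
  let c : Basis (Fin m) K (Fin n → ℝ) := finBasis K _
  let B := b.smulTower c
  have h : n = d * m := by
    have := Module.finrank_eq_card_basis B
    simpa using this
  let σ : Fin d × Fin m ≃ Fin n :=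
    (((finCongr h).trans (finCongr (mul_comm d m))).trans
      (finProdFinEquiv.symm.trans (Equiv.prodComm _ _))).symm
  let B' : Basis (Fin n) ℝ (Fin n → ℝ) := B.reindex σ
  let s := Pi.basisFun ℝ (Fin n)
  let P : (Matrix (Fin n) (Fin n) ℝ)ˣ :=
    ⟨s.toMatrix B', B'.toMatrix s, s.toMatrix_mul_toMatrix_flip B', B'.toMatrix_mul_toMatrix_flip s⟩
  have hconj : ∀ F : (Fin n → ℝ) →ₗ[ℝ] (Fin n → ℝ),
      (P⁻¹).val * LinearMap.toMatrix' F * P.val = LinearMap.toMatrix B' B' F := fun F => by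
    rw [← LinearMap.toMatrix_eq_toMatrix']
    exact basis_toMatrix_mul_linearMap_toMatrix_mul_basis_toMatrix B' s B' s F
  have hblock : ∀ F : (Fin n → ℝ) →ₗ[K] (Fin n → ℝ),
      LinearMap.toMatrix B' B' (F.restrictScalars ℝ) =
        Matrix.reindex (finCongr h.symm) (finCongr h.symm)
          (blockMatrix m e (Matrix.of fun i j => τ (c.repr (F (c j)) i))) := fun F => by
    ext i j
    obtain ⟨i, rfl⟩ := σ.surjective i
    obtain ⟨j, rfl⟩ := σ.surjective j
    have hR : Matrix.reindex (finCongr h.symm) (finCongr h.symm)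
          (blockMatrix m e (Matrix.of fun i j => τ (c.repr (F (c j)) i))) (σ i) (σ j) =
        e (τ (c.repr (F (c j.2)) i.2)) i.1 j.1 := by
      change e (τ (c.repr (F (c (σ.symm (σ j)).2)) (σ.symm (σ i)).2))
        (σ.symm (σ i)).1 (σ.symm (σ j)).1 = _
      simp only [Equiv.symm_apply_apply]
    rw [hR, ← he, LinearMap.toMatrix_apply]
    simp [B', B, Basis.smulTower_repr, Basis.smulTower_apply]
  refine ⟨m, h, P, Set.Subset.antisymm ?_ ?_⟩
  · rintro _ ⟨X, hX, rfl⟩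
    refine ⟨_, ((hblock (X.toLinOfCommute ((h𝒜 X).mp hX))).symm.trans (hconj _).symm).trans ?_⟩
    have : (X.toLinOfCommute ((h𝒜 X).mp hX)).restrictScalars ℝ = Matrix.toLin' X := rfl
    simp [this]
  · rintro _ ⟨C, rfl⟩
    let F : (Fin n → ℝ) →ₗ[K] (Fin n → ℝ) := c.constr ℕ fun j => ∑ i, τ.symm (C i j) • c i
    refine ⟨LinearMap.toMatrix' (F.restrictScalars ℝ),
      (h𝒜 _).mpr (mulVec_smul_toMatrix' F), ?_⟩
    have hC : (Matrix.of fun i j => τ (c.repr (F (c j)) i)) = C := by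
      ext i j
      simp [F, Finsupp.single_apply]
    have := (hconj (F.restrictScalars ℝ)).trans (hblock F)
    rwa [hC] at this

end Blocks

section CoordinateDivisionRing

open Matrix Module

/-- The commutant of an irreducible real algebra of operators is a copy of `ℝ`, `ℂ` or `ℍ`. -/
theorem exists_surjective_algHom_commutant {V : Type*} [AddCommGroup V] [Module ℝ V]
    [FiniteDimensional ℝ V] [Nontrivial V] {A : NonUnitalSubalgebra ℝ (Module.End ℝ V)}
    (hirr : ∀ W : Submodule ℝ V, (∀ a ∈ A, ∀ x ∈ W, a x ∈ W) → W = ⊥ ∨ W = ⊤) :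
    letI D := Module.End (Algebra.adjoin ℝ (A : Set (Module.End ℝ V))) V
    (∃ f : ℝ →ₐ[ℝ] D, Function.Surjective f) ∨ (∃ f : ℂ →ₐ[ℝ] D, Function.Surjective f) ∨
      ∃ f : Quaternion ℝ →ₐ[ℝ] D, Function.Surjective f := by
  classical
  have := isSimpleModule_adjoin hirr
  have := finiteDimensional_end_subalgebra (Algebra.adjoin ℝ (A : Set (Module.End ℝ V)))
  exact exists_surjective_algHom_of_finiteDimensional
    (D := Module.End (Algebra.adjoin ℝ (A : Set (Module.End ℝ V))) V)

/-- An irreducible matrix algebra consists of all matrices linear over its commutant. -/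
theorem exists_module_forall_mem_iff_commute {n : ℕ} [Nonempty (Fin n)]
    {𝒜 : NonUnitalSubalgebra ℝ (Matrix (Fin n) (Fin n) ℝ)}
    {A : NonUnitalSubalgebra ℝ (Module.End ℝ (Fin n → ℝ))}
    (hA : ∀ X, X.toLin' ∈ A ↔ X ∈ 𝒜) (hne : ∃ a ∈ A, a ≠ 0)
    (hirr : ∀ W : Submodule ℝ (Fin n → ℝ), (∀ a ∈ A, ∀ x ∈ W, a x ∈ W) → W = ⊥ ∨ W = ⊤)
    {K : Type*} [DivisionRing K] [Algebra ℝ K]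
    (φ : K →ₐ[ℝ] Module.End (Algebra.adjoin ℝ (A : Set (Module.End ℝ (Fin n → ℝ)))) (Fin n → ℝ))
    (hφ : Function.Surjective φ) :
    ∃ (_ : Module K (Fin n → ℝ)) (_ : IsScalarTower ℝ K (Fin n → ℝ)),
      ∀ X, X ∈ 𝒜 ↔ ∀ (c : K) v, X *ᵥ (c • v) = c • X *ᵥ v := by
  let inst : Module K (Fin n → ℝ) := Module.compHom _ φ.toRingHom
  have hsmul : ∀ (c : K) (v : Fin n → ℝ), c • v = φ c v := fun _ _ => rfl
  refine ⟨inst, ⟨fun r c v => by simp [hsmul]⟩, fun X => ⟨fun hX c v => ?_, fun hX => ?_⟩⟩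
  · exact ((φ c).map_smul (⟨X.toLin', Algebra.subset_adjoin ((hA X).mpr hX)⟩ :
      Algebra.adjoin ℝ (A : Set (Module.End ℝ (Fin n → ℝ)))) v).symm
  · refine (hA X).mp (mem_of_commute_of_irreducible hne hirr fun g v => ?_)
    obtain ⟨c, rfl⟩ := hφ g
    exact hX c v

/-- The real basis `1, i` of `ℂ` represents multiplication by `ε`. -/
theorem basisOneI_repr_mul (c : ℂ) (k l : Fin 2) :
    Complex.basisOneI.repr (Complex.basisOneI l * c) k = epsC c k l := by
  fin_cases k <;> fin_cases l <;> simp [epsC]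

/-- The real basis `1, -i, j, -k` of the quaternions. -/
noncomputable def quaternionBasis : Basis (Fin 4) ℝ (Quaternion ℝ) :=
  Basis.ofEquivFun
    { toFun := fun q => ![q.re, -q.imI, q.imJ, -q.imK]
      invFun := fun x => ⟨x 0, -x 1, x 2, -x 3⟩
      map_add' := fun p q => by ext i; fin_cases i <;> simp [add_comm]
      map_smul' := fun r q => by ext i; fin_cases i <;> simp
      left_inv := fun q => by ext <;> simp
      right_inv := fun x => by ext i; fin_cases i <;> simp }

theorem quaternionBasis_repr_mul (c : Quaternion ℝ) (k l : Fin 4) :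
    quaternionBasis.repr (quaternionBasis l * c) k = epsH (star c) k l := by
  have hrepr : ∀ q, quaternionBasis.repr q k = ![q.re, -q.imI, q.imJ, -q.imK] k := fun _ => rfl
  have hbasis : quaternionBasis l = (⟨(Pi.single l 1 : Fin 4 → ℝ) 0, -(Pi.single l 1 : Fin 4 → ℝ) 1,
      (Pi.single l 1 : Fin 4 → ℝ) 2, -(Pi.single l 1 : Fin 4 → ℝ) 3⟩ : Quaternion ℝ) := by
    simp only [quaternionBasis, Basis.coe_ofEquivFun]
    rfl
  rw [hrepr, Quaternion.re_mul, Quaternion.imI_mul, Quaternion.imJ_mul, Quaternion.imK_mul, hbasis]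
  fin_cases k <;> fin_cases l <;> simp [epsH]

end CoordinateDivisionRing

/-- classification of irreducible ℝ-subalgebras of `Mₙ(ℝ)` according to the
smallest nonzero rank `r` present in the algebra. -/
theorem irreducible_real_subalgebra_classification
    (n : ℕ) (hn : 1 ≤ n) (𝒜 : NonUnitalSubalgebra ℝ (Matrix (Fin n) (Fin n) ℝ))
    -- `𝒜` is irreducible
    (hne : (𝒜 : Set (Matrix (Fin n) (Fin n) ℝ)) ≠ {0})
    (hirr : ∀ W : Submodule ℝ (Fin n → ℝ),
      (∀ A ∈ 𝒜, ∀ x ∈ W, A.mulVec x ∈ W) → W = ⊥ ∨ W = ⊤)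
    -- `r` is the smallest nonzero rank present in `𝒜`
    (r : ℕ) (hr0 : r ≠ 0) (hrmem : ∃ A ∈ 𝒜, A.rank = r)
    (hrmin : ∀ A ∈ 𝒜, A.rank ≠ 0 → r ≤ A.rank) :
    r ∣ n ∧ (r = 1 ∨ r = 2 ∨ r = 4) ∧
    (r = 1 → 𝒜 = ⊤) ∧
    (r = 2 → ∃ m : ℕ, ∃ h : n = 2 * m, ∃ P : (Matrix (Fin n) (Fin n) ℝ)ˣ,
      (fun X => (P⁻¹).val * X * P.val) '' (𝒜 : Set (Matrix (Fin n) (Fin n) ℝ)) =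
        Set.range (fun A : Matrix (Fin m) (Fin m) ℂ =>
          Matrix.reindex (finCongr h.symm) (finCongr h.symm) (epsCMat m A))) ∧
    (r = 4 → ∃ m : ℕ, ∃ h : n = 4 * m, ∃ P : (Matrix (Fin n) (Fin n) ℝ)ˣ,
      (fun X => (P⁻¹).val * X * P.val) '' (𝒜 : Set (Matrix (Fin n) (Fin n) ℝ)) =
        Set.range (fun A : Matrix (Fin m) (Fin m) (Quaternion ℝ) =>
          Matrix.reindex (finCongr h.symm) (finCongr h.symm) (epsHMat m A))) ∧
    (𝒜 = ⊤ ↔ r = 1) := by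
  have : Nonempty (Fin n) := ⟨⟨0, hn⟩⟩
  let A : NonUnitalSubalgebra ℝ (Module.End ℝ (Fin n → ℝ)) :=
    𝒜.map (Matrix.toLinAlgEquiv' : Matrix (Fin n) (Fin n) ℝ ≃ₐ[ℝ] _)
  have hA : ∀ X : Matrix (Fin n) (Fin n) ℝ, X.toLin' ∈ A ↔ X ∈ 𝒜 := fun X => by
    refine ⟨?_, fun h => ⟨X, h, rfl⟩⟩
    rintro ⟨Y, hY, hYX⟩
    exact Matrix.toLin'.injective hYX ▸ hY
  have hneA : ∃ a ∈ A, a ≠ 0 := by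
    obtain ⟨X, hX, hXr⟩ := hrmem
    exact ⟨X.toLin', (hA X).mpr hX, fun h0 => hr0 <| by
      rw [← hXr, (Matrix.toLin'.map_eq_zero_iff).mp h0, Matrix.rank_zero]⟩
  have hirrA : ∀ W : Submodule ℝ (Fin n → ℝ), (∀ a ∈ A, ∀ x ∈ W, a x ∈ W) → W = ⊥ ∨ W = ⊤ :=
    fun W hW => hirr W fun X hX x hx => hW _ ((hA X).mpr hX) x hx
  have htop : 𝒜 = ⊤ → r = 1 := fun h => by
    let E : Matrix (Fin n) (Fin n) ℝ := Matrix.vecMulVec (Pi.single ⟨0, hn⟩ 1) (Pi.single ⟨0, hn⟩ 1)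
    have hE : E.rank ≠ 0 := fun h0 => by
      have hmul : E.mulVecLin = 0 := LinearMap.range_eq_bot.mp (Submodule.finrank_eq_zero.mp h0)
      simpa [E, Matrix.vecMulVec_apply] using
        congrFun (LinearMap.congr_fun hmul (Pi.single ⟨0, hn⟩ 1)) ⟨0, hn⟩
    have hle : r ≤ E.rank := hrmin E (h ▸ NonUnitalAlgebra.mem_top) hE
    have hE1 : E.rank ≤ 1 := Matrix.rank_vecMulVec_le _ _
    omega
  rcases exists_surjective_algHom_commutant hirrA with
    ⟨φ, hφ⟩ | ⟨φ, hφ⟩ | ⟨φ, hφ⟩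
  · obtain ⟨i1, i2, h𝒜⟩ := exists_module_forall_mem_iff_commute hA hneA hirrA φ hφ
    have hr : r = 1 := (finrank_eq_of_minimal_rank hn h𝒜 hr0 hrmem hrmin).trans (by simp)
    have hall : 𝒜 = ⊤ := by
      have hsmul : ∀ (c : ℝ) (v : Fin n → ℝ), i1.smul c v = (Pi.module _ _ _).smul c v :=
        fun c v => by
          have h1 := i2.smul_assoc c 1 v
          rw [smul_eq_mul, mul_one] at h1
          exact h1.trans (congrArg ((Pi.module _ _ _).smul c) (i1.one_smul v))
      refine eq_top_iff.mpr fun X _ => (h𝒜 X).mpr fun c v => ?_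
      exact ((congrArg X.mulVec (hsmul c v)).trans (X.mulVec_smul c v)).trans (hsmul c _).symm
    subst hr
    exact ⟨one_dvd _, Or.inl rfl, fun _ => hall, by omega, by omega, htop, fun _ => hall⟩
  · obtain ⟨i1, i2, h𝒜⟩ := exists_module_forall_mem_iff_commute hA hneA hirrA φ hφ
    have hr : r = 2 := (finrank_eq_of_minimal_rank hn h𝒜 hr0 hrmem hrmin).trans (by simp)
    have hconj := exists_conj_eq_range_blockMatrix h𝒜 Complex.basisOneI (Equiv.refl ℂ) epsC
      basisOneI_repr_mul
    subst hr
    exact ⟨hconj.imp fun _ h => h.1, Or.inr (Or.inl rfl), by omega, fun _ => hconj, by omega,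
      htop, by omega⟩
  · obtain ⟨i1, i2, h𝒜⟩ := exists_module_forall_mem_iff_commute hA hneA hirrA φ hφ
    have hr : r = 4 := (finrank_eq_of_minimal_rank hn h𝒜 hr0 hrmem hrmin).trans
      Quaternion.finrank_eq_four
    have hconj := exists_conj_eq_range_blockMatrix h𝒜 quaternionBasis
      (star_involutive (R := Quaternion ℝ)).toPerm epsH quaternionBasis_repr_mul
    subst hr
    exact ⟨hconj.imp fun _ h => h.1, Or.inr (Or.inr rfl), by omega, by omega, fun _ => hconj,
      htop, by omega⟩
end

section
/- Let n ≥ 1 and let A be an irreducible ℝ-subalgebra of M_n(ℂ), and let r be the smallest nonzero rank of a matrix in A. Then r divides n and r ∈ {1, 2}; if r = 1 then either A = M_n(ℂ) or there is an invertible P ∈ M_n(ℂ) with P⁻¹AP equal to the set of matrices in M_n(ℂ) with all entries real; if r = 2 then there is an invertible P ∈ M_n(ℂ) with P⁻¹AP = ε'_{n/2}(M_{n/2}(ℍ)). -/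
/-- The standard representation `ε' : ℍ → M₂(ℂ)`, sending `q = z + wj` to
`[[z, w], [-conj w, conj z]]`. -/
noncomputable def epsH' (q : Quaternion ℝ) : Matrix (Fin 2) (Fin 2) ℂ :=
  !![⟨q.re, q.imI⟩, ⟨q.imJ, q.imK⟩; ⟨-q.imJ, q.imK⟩, ⟨q.re, -q.imI⟩]

/-- `ε'_m : M_m(ℍ) → M_{2m}(ℂ)`, applying `ε'` entrywise in 2×2 blocks. -/
noncomputable def epsH'Mat (m : ℕ) (A : Matrix (Fin m) (Fin m) (Quaternion ℝ)) :
    Matrix (Fin (2 * m)) (Fin (2 * m)) ℂ :=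
  fun i j => epsH' (A ⟨i.val / 2, by omega⟩ ⟨j.val / 2, by omega⟩)
    ⟨i.val % 2, by omega⟩ ⟨j.val % 2, by omega⟩

/-- A subalgebra of endomorphisms without nontrivial invariant subspaces, over an algebraically
closed field, is everything (Burnside's theorem on matrix algebras). -/
theorem Subalgebra.eq_top_of_irreducible {K V : Type*} [Field K] [IsAlgClosed K] [AddCommGroup V]
    [Module K V] [FiniteDimensional K V] [Nontrivial V] (S : Subalgebra K (Module.End K V))
    (h : ∀ W : Submodule K V, (∀ f ∈ S, ∀ x ∈ W, f x ∈ W) → W = ⊥ ∨ W = ⊤) : S = ⊤ := by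
  have hsimple : IsSimpleModule S V := by
    rw [isSimpleModule_iff]
    refine { eq_bot_or_eq_top := fun W => ?_ }
    rcases h (W.restrictScalars K) (fun f hf x hx => W.smul_mem (⟨f, hf⟩ : S) hx) with hW | hW
    · exact Or.inl ((Submodule.restrictScalars_eq_bot_iff K S V).1 hW)
    · exact Or.inr ((Submodule.restrictScalars_eq_top_iff K S V).1 hW)
  have hschur := (IsSimpleModule.algebraMap_end_bijective_of_isAlgClosed K (A := S) (V := V)).2
  refine eq_top_iff.2 fun f _ => ?_
  let f' : Module.End (Module.End S V) V :=
    { toFun := f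
      map_add' := f.map_add
      map_smul' := fun g x => by
        obtain ⟨c, rfl⟩ := hschur g
        exact f.map_smul c x }
  obtain ⟨s, hs⟩ := Module.finite_def.1 (‹FiniteDimensional K V› : Module.Finite K V)
  obtain ⟨r, hr⟩ := jacobson_density f' s
  have hfr : f = (r : Module.End K V) :=
    LinearMap.ext_on hs fun m hm => hr m hm
  exact hfr ▸ r.2

namespace Matrix

/-- Entrywise complex conjugation of square matrices. -/
noncomputable def conjHom (n : Type*) [Fintype n] [DecidableEq n] :
    Matrix n n ℂ →+* Matrix n n ℂ :=
  (starRingEnd ℂ).mapMatrix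

variable {n : Type*} [Fintype n] [DecidableEq n]

theorem conjHom_apply (X : Matrix n n ℂ) (i j : n) :
    conjHom n X i j = starRingEnd ℂ (X i j) := rfl

@[simp]
theorem conjHom_conjHom (X : Matrix n n ℂ) : conjHom n (conjHom n X) = X := by
  ext i j
  simp [conjHom_apply]

@[simp]
theorem conjHom_smul (c : ℂ) (X : Matrix n n ℂ) :
    conjHom n (c • X) = starRingEnd ℂ c • conjHom n X := by
  ext i j
  simp [conjHom_apply]

theorem conjHom_mulVec (X : Matrix n n ℂ) (v : n → ℂ) :
    conjHom n X *ᵥ star v = star (X *ᵥ v) := by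
  ext i
  simp [mulVec, dotProduct, conjHom_apply]

theorem det_conjHom (X : Matrix n n ℂ) : (conjHom n X).det = starRingEnd ℂ X.det :=
  (RingHom.map_det _ _).symm

/-- Algebra automorphisms of a full matrix algebra over a field are inner. -/
theorem exists_unit_forall_algEquiv_eq {K : Type*} [Field K]
    (f : Matrix n n K ≃ₐ[K] Matrix n n K) :
    ∃ S : (Matrix n n K)ˣ, ∀ X, f X = S.val * X * (S⁻¹).val := by
  let e : Matrix n n K ≃ₐ[K] Module.End K (n → K) := toLinAlgEquiv'
  obtain ⟨T, hT⟩ := ((e.symm.trans f).trans e).eq_linearEquivConjAlgEquiv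
  refine ⟨⟨e.symm T.toLinearMap, e.symm T.symm.toLinearMap, ?_, ?_⟩, fun X => ?_⟩
  · rw [← map_mul, ← map_one e.symm]
    congr 1
    ext; simp
  · rw [← map_mul, ← map_one e.symm]
    congr 1
    ext; simp
  · have := congr($hT (e X))
    apply e.injective
    simp only [Units.inv_mk, map_mul, AlgEquiv.apply_symm_apply]
    simp only [AlgEquiv.trans_apply, AlgEquiv.symm_apply_apply] at this
    rw [this]
    rfl

section RealForm

variable {𝒜 : NonUnitalSubalgebra ℝ (Matrix n n ℂ)}

/-- An irreducible real algebra of complex matrices spans all matrices over `ℂ`. -/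
theorem exists_add_I_smul_of_irreducible [Nonempty n]
    (hne : (𝒜 : Set (Matrix n n ℂ)) ≠ {0})
    (hirr : ∀ W : Submodule ℂ (n → ℂ),
      (∀ A ∈ 𝒜, ∀ x ∈ W, A.mulVec x ∈ W) → W = ⊥ ∨ W = ⊤) (X : Matrix n n ℂ) :
    ∃ a ∈ 𝒜, ∃ b ∈ 𝒜, X = a + Complex.I • b := by
  have hadj : Algebra.adjoin ℂ (𝒜 : Set (Matrix n n ℂ)) = ⊤ := by
    let e : Matrix n n ℂ ≃ₐ[ℂ] Module.End ℂ (n → ℂ) := toLinAlgEquiv'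
    have h1 := Subalgebra.eq_top_of_irreducible
      ((Algebra.adjoin ℂ (𝒜 : Set (Matrix n n ℂ))).map e.toAlgHom) (fun W hW => hirr W
        fun A hA x hx => hW (e A)
          (Subalgebra.mem_map.2 ⟨A, Algebra.subset_adjoin hA, rfl⟩) x hx)
    refine eq_top_iff.2 fun Y _ => ?_
    obtain ⟨Z, hZ, hZY⟩ := Subalgebra.mem_map.1 (h1 ▸ Algebra.mem_top : e Y ∈ _)
    exact e.injective hZY ▸ hZ
  let T : Set (Matrix n n ℂ) := {X | ∃ a ∈ 𝒜, ∃ b ∈ 𝒜, X = a + Complex.I • b}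
  have hsub : ∀ a ∈ 𝒜, a ∈ T := fun a ha => ⟨a, ha, 0, 𝒜.zero_mem, by simp⟩
  have hadd : ∀ {x y}, x ∈ T → y ∈ T → x + y ∈ T := by
    rintro _ _ ⟨a, ha, b, hb, rfl⟩ ⟨c, hc, d, hd, rfl⟩
    exact ⟨a + c, add_mem ha hc, b + d, add_mem hb hd, by rw [smul_add]; abel⟩
  have hsmul : ∀ (c : ℂ) {x}, x ∈ T → c • x ∈ T := by
    rintro c _ ⟨a, ha, b, hb, rfl⟩
    refine ⟨c.re • a - c.im • b, sub_mem (SMulMemClass.smul_mem _ ha) (SMulMemClass.smul_mem _ hb),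
      c.im • a + c.re • b, add_mem (SMulMemClass.smul_mem _ ha) (SMulMemClass.smul_mem _ hb), ?_⟩
    ext i j
    apply Complex.ext <;> simp <;> ring
  have hmul : ∀ {x y}, x ∈ T → y ∈ T → x * y ∈ T := by
    rintro _ _ ⟨a, ha, b, hb, rfl⟩ ⟨c, hc, d, hd, rfl⟩
    refine ⟨a * c - b * d, sub_mem (mul_mem ha hc) (mul_mem hb hd), a * d + b * c,
      add_mem (mul_mem ha hd) (mul_mem hb hc), ?_⟩
    simp only [add_mul, mul_add, smul_mul_assoc, mul_smul_comm, smul_add, smul_smul,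
      Complex.I_mul_I, neg_smul, one_smul]
    abel
  have hneg : ∀ {x}, x ∈ T → -x ∈ T := fun hx => by simpa using hsmul (-1) hx
  have hleft : ∀ (y : Matrix n n ℂ) {x}, x ∈ T → y * x ∈ T := by
    intro y x hx
    have hy : y ∈ Algebra.adjoin ℂ (𝒜 : Set (Matrix n n ℂ)) := hadj ▸ Algebra.mem_top
    induction hy using Algebra.adjoin_induction generalizing x with
    | mem a ha => exact hmul (hsub a ha) hx
    | algebraMap c => simpa [Algebra.algebraMap_eq_smul_one] using hsmul c hx
    | add y z _ _ h1 h2 => rw [add_mul]; exact hadd (h1 hx) (h2 hx)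
    | mul y z _ _ h1 h2 => rw [mul_assoc]; exact h1 (h2 hx)
  have hright : ∀ (y : Matrix n n ℂ) {x}, x ∈ T → x * y ∈ T := by
    intro y x hx
    have hy : y ∈ Algebra.adjoin ℂ (𝒜 : Set (Matrix n n ℂ)) := hadj ▸ Algebra.mem_top
    induction hy using Algebra.adjoin_induction generalizing x with
    | mem a ha => exact hmul hx (hsub a ha)
    | algebraMap c => simpa [Algebra.algebraMap_eq_smul_one] using hsmul c hx
    | add y z _ _ h1 h2 => rw [mul_add]; exact hadd (h1 hx) (h2 hx)
    | mul y z _ _ h1 h2 => rw [← mul_assoc]; exact h2 (h1 hx)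
  let I : TwoSidedIdeal (Matrix n n ℂ) := TwoSidedIdeal.mk' T (hsub 0 𝒜.zero_mem) hadd hneg
    (fun {y x} hx => hleft y hx) (fun {x y} hx => hright y hx)
  have hI : ∀ x, x ∈ I ↔ x ∈ T := fun x => TwoSidedIdeal.mem_mk' ..
  rcases eq_bot_or_eq_top I with h | h
  · refine (hne (Set.eq_singleton_iff_unique_mem.2 ⟨𝒜.zero_mem, fun a ha => ?_⟩)).elim
    have := (hI a).2 (hsub a ha)
    rw [h] at this
    simpa using this
  · exact (hI X).1 (h ▸ trivial)

theorem eq_top_or_forall_I_smul_mem [Nonempty n]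
    (hspan : ∀ X : Matrix n n ℂ, ∃ a ∈ 𝒜, ∃ b ∈ 𝒜, X = a + Complex.I • b) :
    𝒜 = ⊤ ∨ ∀ a ∈ 𝒜, Complex.I • a ∈ 𝒜 → a = 0 := by
  have hII : ∀ x : Matrix n n ℂ, Complex.I • Complex.I • x = -x := fun x => by
    rw [smul_smul, Complex.I_mul_I, neg_smul, one_smul]
  let T : Set (Matrix n n ℂ) := {x | x ∈ 𝒜 ∧ Complex.I • x ∈ 𝒜}
  have hadd : ∀ {x y}, x ∈ T → y ∈ T → x + y ∈ T := fun hx hy =>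
    ⟨add_mem hx.1 hy.1, by rw [smul_add]; exact add_mem hx.2 hy.2⟩
  have hneg : ∀ {x}, x ∈ T → -x ∈ T := fun hx =>
    ⟨neg_mem hx.1, by rw [smul_neg]; exact neg_mem hx.2⟩
  have hI : ∀ {x}, x ∈ T → Complex.I • x ∈ T := fun hx =>
    ⟨hx.2, by rw [hII]; exact neg_mem hx.1⟩
  have hleft : ∀ {y x}, x ∈ T → y * x ∈ T := by
    intro y x hx
    obtain ⟨a, ha, b, hb, rfl⟩ := hspan y
    have key : ∀ c ∈ 𝒜, c * x ∈ T := fun c hc =>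
      ⟨mul_mem hc hx.1, by rw [← mul_smul_comm]; exact mul_mem hc hx.2⟩
    rw [add_mul, smul_mul_assoc]
    exact hadd (key a ha) (hI (key b hb))
  have hright : ∀ {x y}, x ∈ T → x * y ∈ T := by
    intro x y hx
    obtain ⟨a, ha, b, hb, rfl⟩ := hspan y
    have key : ∀ c ∈ 𝒜, x * c ∈ T := fun c hc =>
      ⟨mul_mem hx.1 hc, by rw [← smul_mul_assoc]; exact mul_mem hx.2 hc⟩
    rw [mul_add, mul_smul_comm]
    exact hadd (key a ha) (hI (key b hb))
  let I : TwoSidedIdeal (Matrix n n ℂ) := TwoSidedIdeal.mk' T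
    ⟨𝒜.zero_mem, by rw [smul_zero]; exact 𝒜.zero_mem⟩ hadd hneg hleft hright
  have hIT : ∀ x, x ∈ I ↔ x ∈ T := fun x => TwoSidedIdeal.mem_mk' ..
  rcases eq_bot_or_eq_top I with h | h
  · refine Or.inr fun a ha ha' => ?_
    have := (hIT a).2 ⟨ha, ha'⟩
    rw [h] at this
    simpa using this
  · exact Or.inl (SetLike.ext fun x =>
      ⟨fun _ => NonUnitalAlgebra.mem_top, fun _ => ((hIT x).1 (h ▸ trivial)).1⟩)

/-- A real form of the full matrix algebra is the fixed ring of an antilinear involution. -/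
theorem exists_conjugation
    (hspan : ∀ X : Matrix n n ℂ, ∃ a ∈ 𝒜, ∃ b ∈ 𝒜, X = a + Complex.I • b)
    (hdisj : ∀ a ∈ 𝒜, Complex.I • a ∈ 𝒜 → a = 0) :
    ∃ σ : Matrix n n ℂ →+* Matrix n n ℂ, (∀ (c : ℂ) X, σ (c • X) = starRingEnd ℂ c • σ X) ∧
      (∀ X, σ (σ X) = X) ∧ ∀ X, X ∈ 𝒜 ↔ σ X = X := by
  have hII : ∀ x : Matrix n n ℂ, Complex.I • Complex.I • x = -x := fun x => by
    rw [smul_smul, Complex.I_mul_I, neg_smul, one_smul]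
  have huniq : ∀ a ∈ 𝒜, ∀ b ∈ 𝒜, ∀ c ∈ 𝒜, ∀ d ∈ 𝒜,
      a + Complex.I • b = c + Complex.I • d → a = c ∧ b = d := by
    intro a ha b hb c hc d hd h
    have h1 : Complex.I • (d - b) = a - c := by
      rw [smul_sub, sub_eq_sub_iff_add_eq_add, add_comm, ← h]
    have h2 := sub_eq_zero.1 (hdisj _ (sub_mem hd hb) (h1 ▸ sub_mem ha hc))
    subst h2
    exact ⟨add_right_cancel h, rfl⟩
  choose re hre im him hX using hspan
  let σ : Matrix n n ℂ → Matrix n n ℂ := fun X => re X - Complex.I • im X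
  have hσ : ∀ a ∈ 𝒜, ∀ b ∈ 𝒜, σ (a + Complex.I • b) = a - Complex.I • b := by
    intro a ha b hb
    obtain ⟨h1, h2⟩ := huniq _ (hre _) _ (him _) a ha b hb (hX (a + Complex.I • b)).symm
    simp only [σ, h1, h2]
  have hσσ : ∀ X, σ (σ X) = X := by
    intro X
    have : σ X = re X + Complex.I • (-im X) := by simp only [σ]; rw [smul_neg, sub_eq_add_neg]
    rw [this, hσ _ (hre X) _ (neg_mem (him X)), smul_neg, sub_neg_eq_add, ← hX X]
  have hmul : ∀ X Y, σ (X * Y) = σ X * σ Y := by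
    intro X Y
    have h := hσ (re X * re Y - im X * im Y)
      (sub_mem (mul_mem (hre X) (hre Y)) (mul_mem (him X) (him Y))) (re X * im Y + im X * re Y)
      (add_mem (mul_mem (hre X) (him Y)) (mul_mem (him X) (hre Y)))
    have e : X * Y = re X * re Y - im X * im Y + Complex.I • (re X * im Y + im X * re Y) := by
      conv_lhs => rw [hX X, hX Y]
      simp only [add_mul, mul_add, smul_mul_assoc, mul_smul_comm, smul_add, hII]
      abel
    rw [e, h]
    simp only [σ, sub_mul, mul_sub, smul_mul_assoc, mul_smul_comm, smul_add, smul_sub, hII]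
    abel
  have hadd : ∀ X Y, σ (X + Y) = σ X + σ Y := by
    intro X Y
    have h := hσ _ (add_mem (hre X) (hre Y)) _ (add_mem (him X) (him Y))
    have e : X + Y = re X + re Y + Complex.I • (im X + im Y) := by
      conv_lhs => rw [hX X, hX Y]
      rw [smul_add]
      abel
    rw [e, h]
    simp only [σ, smul_add]
    abel
  have hone : σ 1 = 1 := by
    have := hmul (σ 1) 1
    rwa [mul_one, hσσ, one_mul, eq_comm] at this
  have hzero : σ 0 = 0 := by simpa using hadd 0 0
  refine ⟨⟨⟨⟨σ, hone⟩, hmul⟩, hzero, hadd⟩, ?_, hσσ, fun X => ⟨fun h => ?_, fun h => ?_⟩⟩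
  · intro c X
    change σ (c • X) = starRingEnd ℂ c • σ X
    have h := hσ (c.re • re X - c.im • im X)
      (sub_mem (SMulMemClass.smul_mem _ (hre X)) (SMulMemClass.smul_mem _ (him X)))
      (c.im • re X + c.re • im X)
      (add_mem (SMulMemClass.smul_mem _ (hre X)) (SMulMemClass.smul_mem _ (him X)))
    have e : c • X = c.re • re X - c.im • im X + Complex.I • (c.im • re X + c.re • im X) := by
      conv_lhs => rw [hX X]
      ext i j
      apply Complex.ext <;> simp <;> ring
    rw [e, h]
    ext i j
    apply Complex.ext <;> simp [σ] <;> ring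
  · simpa using hσ X h 0 𝒜.zero_mem
  · change σ X = X at h
    have h0 : re X - Complex.I • im X = re X + Complex.I • im X := h.trans (hX X)
    have h1 := (huniq (re X) (hre X) (-im X) (neg_mem (him X)) (re X) (hre X) (im X) (him X)
      (by rw [smul_neg, ← sub_eq_add_neg, h0])).2
    have h2 : im X = 0 := by
      have : (2 : ℂ) • im X = 0 := by rw [two_smul]; nth_rewrite 1 [← h1]; simp
      simpa using this
    rw [hX X, h2, smul_zero, add_zero]
    exact hre X

theorem exists_unit_mem_iff_mul_eq_mul_conjHom [Nonempty n]
    (hspan : ∀ X : Matrix n n ℂ, ∃ a ∈ 𝒜, ∃ b ∈ 𝒜, X = a + Complex.I • b)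
    (hdisj : ∀ a ∈ 𝒜, Complex.I • a ∈ 𝒜 → a = 0) :
    ∃ (S : Matrix n n ℂ) (ε : ℂ), (ε = 1 ∨ ε = -1) ∧ S * conjHom n S = ε • 1 ∧
      ∀ X, X ∈ 𝒜 ↔ X * S = S * conjHom n X := by
  obtain ⟨σ, hsmul, hσσ, hmem⟩ := exists_conjugation hspan hdisj
  let τ : Matrix n n ℂ →ₐ[ℂ] Matrix n n ℂ :=
    AlgHom.ofLinearMap
      { toFun := fun X => σ (conjHom n X)
        map_add' := by simp
        map_smul' := by simp [hsmul] } (by simp) (by simp)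
  have hτ : ∀ X, τ X = σ (conjHom n X) := fun _ => rfl
  have hbij : Function.Bijective τ := by
    refine Function.bijective_iff_has_inverse.2 ⟨fun X => conjHom n (σ X), fun X => ?_, fun X => ?_⟩
    · simp [hτ, hσσ]
    · simp [hτ, hσσ]
  obtain ⟨S, hS⟩ := exists_unit_forall_algEquiv_eq (AlgEquiv.ofBijective τ hbij)
  have hS' : ∀ X, σ X = S.val * conjHom n X * (S⁻¹).val := fun X => by
    simpa [hτ] using hS (conjHom n X)
  have hinv : ∀ X, X ∈ 𝒜 ↔ X * S.val = S.val * conjHom n X := fun X => by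
    rw [hmem, hS', Units.mul_inv_eq_iff_eq_mul, eq_comm]
  have hcomm : ∀ X, X * (S.val * conjHom n S.val) = (S.val * conjHom n S.val) * X := by
    intro X
    have h1 : conjHom n (S⁻¹).val * conjHom n S.val = 1 := by rw [← map_mul]; simp
    have h := hσσ X
    rw [hS', hS'] at h
    simp only [map_mul, conjHom_conjHom] at h
    rw [Units.mul_inv_eq_iff_eq_mul] at h
    rw [← mul_assoc, ← h]
    simp only [mul_assoc, h1, mul_one]
  obtain ⟨c, hc⟩ : ∃ c : ℂ, c • (1 : Matrix n n ℂ) = S.val * conjHom n S.val := by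
    have : S.val * conjHom n S.val ∈ Set.center (Matrix n n ℂ) :=
      Semigroup.mem_center_iff.2 hcomm
    rw [center_eq_range] at this
    obtain ⟨c, hc⟩ := this
    exact ⟨c, by rw [← hc, smul_one_eq_diagonal]; rfl⟩
  have hc0 : c ≠ 0 := by
    rintro rfl
    rw [zero_smul] at hc
    have h1 : IsUnit (S.val * conjHom n S.val) := S.isUnit.mul (S.isUnit.map _)
    exact not_isUnit_zero (hc ▸ h1)
  have hcreal : starRingEnd ℂ c = c := by
    have h1 : starRingEnd ℂ c • (1 : Matrix n n ℂ) = conjHom n S.val * S.val := by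
      have := congr(conjHom n $hc)
      simpa using this
    have h2 : S.val * (conjHom n S.val * S.val) = S.val * conjHom n S.val * S.val :=
      (mul_assoc _ _ _).symm
    rw [← h1, ← hc, mul_smul_comm, smul_mul_assoc, mul_one, one_mul] at h2
    by_contra hne
    have h3 : (starRingEnd ℂ c - c) • S.val = 0 := by rw [sub_smul, h2, sub_self]
    exact S.ne_zero ((smul_eq_zero.1 h3).resolve_left (sub_ne_zero.2 hne))
  obtain ⟨x, rfl⟩ := Complex.conj_eq_iff_real.1 hcreal
  have hx : x ≠ 0 := by simpa using hc0
  let t : ℝ := (√|x|)⁻¹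
  have ht : t * t * x = 1 ∨ t * t * x = -1 := by
    have h1 : t * t * |x| = 1 := by
      have : √|x| * √|x| = |x| := Real.mul_self_sqrt (abs_nonneg x)
      have h0 : √|x| ≠ 0 := (Real.sqrt_pos.2 (abs_pos.2 hx)).ne'
      simp only [t]
      field_simp
      rw [sq, this]
    rcases abs_cases x with ⟨h, _⟩ | ⟨h, _⟩ <;> rw [h] at h1
    · exact Or.inl h1
    · right; linarith
  have ht0 : (t : ℂ) ≠ 0 := by
    have : t ≠ 0 := by rintro h; simp [h] at ht
    exact_mod_cast this
  refine ⟨(t : ℂ) • S.val, (t * t * x : ℝ), ?_, ?_, fun X => ?_⟩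
  · rcases ht with h | h <;> rw [h] <;> simp
  · rw [conjHom_smul, smul_mul_smul_comm, ← hc, smul_smul]
    simp
  · rw [hinv, mul_smul_comm, smul_mul_assoc]
    exact (smul_right_injective _ ht0).eq_iff.symm

end RealForm

/-- A form of Hilbert's Theorem 90 for the semilinear maps `v ↦ S * conj v`. -/
theorem exists_unit_mul_conjHom_eq {S J : Matrix n n ℂ} {ε : ℂ} (hε : ε = 1 ∨ ε = -1)
    (hS : S * conjHom n S = ε • 1) (hJ : J * conjHom n J = ε • 1) :
    ∃ P : (Matrix n n ℂ)ˣ, S * conjHom n P.val = P.val * J := by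
  have hεε : ε * ε = 1 := by rcases hε with rfl | rfl <;> norm_num
  have hεc : starRingEnd ℂ ε = ε := by rcases hε with rfl | rfl <;> simp
  have hJ' : conjHom n J * J = ε • 1 := by simpa [hεc] using congr(conjHom n $hJ)
  let M : Matrix n n ℂ := S * (ε • conjHom n J)
  let l : ℝ → ℂ := fun s => s + Complex.I
  have hl : ∀ s, starRingEnd ℂ (l s) ≠ 0 := fun s h => by
    have := congr(Complex.im $h)
    simp [l] at this
  obtain ⟨s, hdet⟩ : ∃ s, (scalar n (l s / starRingEnd ℂ (l s)) - -M).det ≠ 0 := by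
    by_contra! hroot
    have hinj : Function.Injective fun s => l s / starRingEnd ℂ (l s) := by
      intro s s' h
      have h' := (div_eq_div_iff (hl s) (hl s')).1 h
      have := congr(Complex.im $h')
      simp [l] at this
      linarith
    refine Set.infinite_range_of_injective hinj
      ((Polynomial.finite_setOfPred_isRoot (charpoly_monic (-M)).ne_zero).subset ?_)
    rintro _ ⟨s, rfl⟩
    exact (eval_charpoly _ _).trans (hroot s)
  have ht := hl s
  generalize l s = t at hdet ht
  let P : Matrix n n ℂ := t • 1 + starRingEnd ℂ t • M
  have hP : IsUnit P := by
    have : P = starRingEnd ℂ t • (scalar n (t / starRingEnd ℂ t) - -M) := by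
      rw [sub_neg_eq_add, smul_add, scalar_apply, ← smul_one_eq_diagonal, smul_smul,
        mul_div_cancel₀ _ ht]
    rw [isUnit_iff_isUnit_det, this, det_smul, isUnit_iff_ne_zero]
    exact mul_ne_zero (pow_ne_zero _ ht) hdet
  refine ⟨hP.unit, ?_⟩
  change S * conjHom n P = P * J
  simp only [P, M, map_add, conjHom_smul, map_mul, conjHom_conjHom, map_one, mul_add, add_mul,
    mul_smul_comm, smul_mul_assoc, mul_one, one_mul, Complex.conj_conj, mul_assoc, hJ', smul_smul,
    hεc]
  rw [← mul_assoc, hS]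
  simp only [smul_mul_assoc, one_mul, smul_smul]
  rw [add_comm]
  congr 2
  · linear_combination t * hεε
  · linear_combination (-starRingEnd ℂ t) * hεε

theorem rank_add_le_add {m l K : Type*} [Fintype m] [Fintype l] [Field K] (A B : Matrix m l K) :
    (A + B).rank ≤ A.rank + B.rank := by
  rw [rank, rank, rank, mulVecLin_add]
  exact (Submodule.finrank_mono (LinearMap.range_add_le _ _)).trans
    (Submodule.finrank_add_le_finrank_add_finrank _ _)

theorem exists_rank_le_two [Nonempty n] {S : Matrix n n ℂ} {ε : ℂ} (hε : ε = 1 ∨ ε = -1)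
    (hS : S * conjHom n S = ε • 1) :
    ∃ X : Matrix n n ℂ, X * S = S * conjHom n X ∧ X ≠ 0 ∧ X.rank ≤ 2 := by
  have hεε : ε * ε = 1 := by rcases hε with rfl | rfl <;> norm_num
  have hεc : starRingEnd ℂ ε = ε := by rcases hε with rfl | rfl <;> simp
  have hS' : conjHom n S * S = ε • 1 := by simpa [hεc] using congr(conjHom n $hS)
  obtain ⟨i⟩ := ‹Nonempty n›
  let E : Matrix n n ℂ := vecMulVec (Pi.single i 1) (Pi.single i 1)
  let F : Matrix n n ℂ := S * conjHom n E * conjHom n S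
  have hE : E.rank ≤ 1 := rank_vecMulVec_le _ _
  have hE' : (conjHom n E).rank ≤ 1 := by
    have : conjHom n E = E := by
      ext a b
      simp only [E, conjHom_apply, vecMulVec_apply, Pi.single_apply]
      split_ifs <;> simp
    rwa [this]
  have hF : F.rank ≤ 1 := (rank_mul_le_left _ _).trans ((rank_mul_le_right _ _).trans hE')
  have hFS : F * S = ε • (S * conjHom n E) := by
    simp only [F, mul_assoc, hS', mul_smul_comm, mul_one]
  have hSF : S * conjHom n F = ε • (E * S) := by
    simp only [F, map_mul, conjHom_conjHom, ← mul_assoc, hS, smul_mul_assoc, one_mul]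
  have hrank : ∀ c d : ℂ, (c • E + d • F).rank ≤ 2 := fun c d => by
    have h : ∀ (c : ℂ) (A : Matrix n n ℂ), A.rank ≤ 1 → (c • A).rank ≤ 1 := fun c A hA => by
      rw [smul_eq_diagonal_mul]
      exact (rank_mul_le_right _ _).trans hA
    exact (rank_add_le_add _ _).trans (add_le_add (h c E hE) (h d F hF))
  have hcomm : ∀ c : ℂ, (c • E + (starRingEnd ℂ c * ε) • F) * S
      = S * conjHom n (c • E + (starRingEnd ℂ c * ε) • F) := fun c => by
    simp only [add_mul, smul_mul_assoc, hFS, map_add, conjHom_smul, mul_add, mul_smul_comm, hSF,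
      smul_smul, map_mul, Complex.conj_conj, hεc, mul_assoc, hεε, mul_one]
    rw [add_comm]
  by_contra! h
  have h1 : ∀ c : ℂ, c • E + (starRingEnd ℂ c * ε) • F = 0 := fun c => by
    by_contra h0
    exact absurd (h _ (hcomm c) h0) (not_lt.2 (hrank _ _))
  have h2 := h1 1
  have h3 := congr(Complex.I • $(h1 Complex.I))
  simp only [smul_add, smul_smul, map_one, one_smul, one_mul, Complex.conj_I, Complex.I_mul_I,
    smul_zero, ← mul_assoc, mul_neg, neg_neg, neg_smul] at h2 h3
  have h4 : E = 0 := by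
    have : (2 : ℂ) • E = 0 := by
      rw [two_smul]
      calc E + E = (E + ε • F) - (-E + ε • F) := by abel
        _ = 0 := by rw [h2, h3, sub_zero]
    simpa using this
  have := congr($h4 i i)
  simp [E, vecMulVec_apply] at this

theorem rank_ne_one_of_mul_eq_mul_conjHom {S X : Matrix n n ℂ} (hS : S * conjHom n S = -1)
    (hX : X * S = S * conjHom n X) : X.rank ≠ 1 := by
  intro h
  obtain ⟨⟨u, v, hv⟩, hu0, hu⟩ := finrank_eq_one_iff'.1 h
  have hu0' : u ≠ 0 := fun h => hu0 (Subtype.ext h)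
  obtain ⟨c, hc⟩ := hu ⟨S *ᵥ star u, S *ᵥ star v, by
    simp only [mulVecLin_apply] at hv ⊢
    rw [mulVec_mulVec, hX, ← mulVec_mulVec, conjHom_mulVec, hv]⟩
  have hc' : c • u = S *ᵥ star u := congr(($hc).1)
  have h1 : S *ᵥ star (S *ᵥ star u) = -u := by
    rw [← conjHom_mulVec, star_star, mulVec_mulVec, hS, neg_mulVec, one_mulVec]
  rw [← hc', star_smul, mulVec_smul, ← hc', smul_smul] at h1
  have h2 : (star c * c + 1) • u = 0 := by rw [add_smul, h1, one_smul, neg_add_cancel]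
  have h3 := (smul_eq_zero.1 h2).resolve_right hu0'
  have h4 : star c * c = ((Complex.normSq c : ℝ) : ℂ) := Complex.normSq_eq_conj_mul_self.symm
  rw [h4] at h3
  have h5 : Complex.normSq c + 1 = 0 := by exact_mod_cast h3
  linarith [Complex.normSq_nonneg c]

theorem even_card_of_mul_conjHom_eq_neg_one {S : Matrix n n ℂ} (hS : S * conjHom n S = -1) :
    Even (Fintype.card n) := by
  by_contra h
  have h1 := congr(det $hS)
  rw [det_mul, det_conjHom, Complex.mul_conj, det_neg, (Nat.not_even_iff_odd.1 h).neg_one_pow,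
    det_one, mul_one] at h1
  have h2 : Complex.normSq S.det = -1 := by exact_mod_cast h1
  linarith [Complex.normSq_nonneg S.det]

theorem image_conj_eq {𝒜 : Set (Matrix n n ℂ)} {S J : Matrix n n ℂ} {P : (Matrix n n ℂ)ˣ}
    (hmem : ∀ X, X ∈ 𝒜 ↔ X * S = S * conjHom n X) (hP : S * conjHom n P.val = P.val * J) :
    (fun X => (P⁻¹).val * X * P.val) '' 𝒜 = {X | X * J = J * conjHom n X} := by
  have key : ∀ Y, P.val * Y * (P⁻¹).val ∈ 𝒜 ↔ Y * J = J * conjHom n Y := by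
    intro Y
    have hu : IsUnit (conjHom n P.val) := P.isUnit.map _
    rw [hmem, ← hu.mul_left_inj, ← P.isUnit.mul_right_inj (b := Y * J)]
    have e1 : P.val * Y * (P⁻¹).val * S * conjHom n P.val = P.val * (Y * J) := by
      rw [mul_assoc, hP]
      simp [mul_assoc]
    have e2 : S * conjHom n (P.val * Y * (P⁻¹).val) * conjHom n P.val
        = P.val * (J * conjHom n Y) := by
      have h : conjHom n (P⁻¹).val * conjHom n P.val = 1 := by rw [← map_mul]; simp
      rw [map_mul, map_mul, mul_assoc, mul_assoc, h, mul_one, ← mul_assoc, hP, mul_assoc]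
    rw [e1, e2]
  ext Y
  constructor
  · rintro ⟨X, hX, rfl⟩
    exact (key _).1 (by simpa [mul_assoc] using hX)
  · exact fun h => ⟨_, (key Y).2 h, by simp [mul_assoc]⟩

end Matrix

section Quaternion

/-- The other index of the `2 × 2` block containing the index `i`. -/
def blockSwap {m : ℕ} (i : Fin (2 * m)) : Fin (2 * m) :=
  ⟨if i.val % 2 = 0 then i.val + 1 else i.val - 1, by split_ifs <;> omega⟩

/-- The index at position `c` of the block with number `a`. -/
def blockIndex {m : ℕ} (a : Fin m) (c : Fin 2) : Fin (2 * m) :=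
  ⟨2 * a.val + c.val, by omega⟩

theorem exists_eq_blockIndex {m : ℕ} (i : Fin (2 * m)) : ∃ a c, i = blockIndex (m := m) a c :=
  ⟨⟨i.val / 2, by omega⟩, ⟨i.val % 2, by omega⟩, by ext; simp only [blockIndex]; omega⟩

theorem epsH'Mat_blockIndex {m : ℕ} (A : Matrix (Fin m) (Fin m) (Quaternion ℝ)) (a b : Fin m)
    (c d : Fin 2) : epsH'Mat m A (blockIndex a c) (blockIndex b d) = epsH' (A a b) c d := by
  have h1 : ∀ (a : Fin m) (c : Fin 2) h, (⟨(blockIndex a c).val / 2, h⟩ : Fin m) = a := by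
    intro a c h; ext; simp only [blockIndex]; omega
  have h2 : ∀ (a : Fin m) (c : Fin 2) h, (⟨(blockIndex a c).val % 2, h⟩ : Fin 2) = c := by
    intro a c h; ext; simp only [blockIndex]; omega
  simp only [epsH'Mat, h1, h2]

theorem blockIndex_mod_two {m : ℕ} (a : Fin m) (c : Fin 2) :
    (blockIndex a c).val % 2 = c.val := by
  simp only [blockIndex]
  omega

theorem blockSwap_blockIndex {m : ℕ} (a : Fin m) (c : Fin 2) :
    blockSwap (blockIndex a c) = blockIndex a (1 - c) := by
  ext
  fin_cases c <;> simp [blockSwap, blockIndex]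

/-- The block diagonal matrix with `2 × 2` diagonal blocks `[[0, 1], [-1, 0]]`. -/
noncomputable def quaternionJ (m : ℕ) : Matrix (Fin (2 * m)) (Fin (2 * m)) ℂ :=
  Matrix.of fun i j => if j = blockSwap i then (if i.val % 2 = 0 then 1 else -1) else 0

theorem quaternionJ_apply {m : ℕ} (i j : Fin (2 * m)) :
    quaternionJ m i j = if j = blockSwap i then (if i.val % 2 = 0 then 1 else -1) else 0 :=
  rfl

theorem blockSwap_blockSwap {m : ℕ} (i : Fin (2 * m)) : blockSwap (blockSwap i) = i := by
  ext
  simp only [blockSwap]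
  split_ifs <;> omega

theorem mul_quaternionJ_apply {m : ℕ} (X : Matrix (Fin (2 * m)) (Fin (2 * m)) ℂ)
    (i j : Fin (2 * m)) :
    (X * quaternionJ m) i j = X i (blockSwap j) * (if j.val % 2 = 0 then -1 else 1) := by
  rw [Matrix.mul_apply, Finset.sum_eq_single (blockSwap j)]
  · rw [quaternionJ_apply, if_pos (blockSwap_blockSwap j).symm]
    congr 1
    simp only [blockSwap]
    split_ifs <;> first | rfl | omega
  · intro k _ hk
    rw [quaternionJ_apply, if_neg, mul_zero]
    rintro rfl
    exact hk (blockSwap_blockSwap k).symm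
  · simp

theorem quaternionJ_mul_apply {m : ℕ} (X : Matrix (Fin (2 * m)) (Fin (2 * m)) ℂ)
    (i j : Fin (2 * m)) :
    (quaternionJ m * X) i j = (if i.val % 2 = 0 then 1 else -1) * X (blockSwap i) j := by
  rw [Matrix.mul_apply, Finset.sum_eq_single (blockSwap i)]
  · rw [quaternionJ_apply, if_pos rfl]
  · intro k _ hk
    rw [quaternionJ_apply, if_neg hk, zero_mul]
  · simp

theorem quaternionJ_mul_conjHom (m : ℕ) :
    quaternionJ m * Matrix.conjHom _ (quaternionJ m) = -1 := by
  ext i j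
  rw [quaternionJ_mul_apply, Matrix.conjHom_apply, quaternionJ_apply, blockSwap_blockSwap,
    Matrix.neg_apply, Matrix.one_apply]
  by_cases h : i = j
  · subst h
    simp only [blockSwap]
    split_ifs <;> first | omega | simp
  · simp [h, Ne.symm h]

theorem range_epsH'Mat (m : ℕ) :
    Set.range (epsH'Mat m) =
      {X | X * quaternionJ m = quaternionJ m * Matrix.conjHom _ X} := by
  ext X
  simp only [Set.mem_range, Set.mem_ofPred_eq]
  constructor
  · rintro ⟨A, rfl⟩
    ext i j
    obtain ⟨a, c, rfl⟩ := exists_eq_blockIndex i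
    obtain ⟨b, d, rfl⟩ := exists_eq_blockIndex j
    rw [mul_quaternionJ_apply, quaternionJ_mul_apply, Matrix.conjHom_apply]
    simp only [blockSwap_blockIndex, blockIndex_mod_two, epsH'Mat_blockIndex]
    fin_cases c <;> fin_cases d <;> simp [epsH', Complex.ext_iff]
  · intro h
    refine ⟨Matrix.of fun a b => ⟨(X (blockIndex a 0) (blockIndex b 0)).re,
      (X (blockIndex a 0) (blockIndex b 0)).im, (X (blockIndex a 0) (blockIndex b 1)).re,
      (X (blockIndex a 0) (blockIndex b 1)).im⟩, ?_⟩
    have key : ∀ (a b : Fin m) (c d : Fin 2),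
        X (blockIndex a c) (blockIndex b (1 - d)) * (if d.val = 0 then -1 else 1) =
          (if c.val = 0 then 1 else -1) *
            starRingEnd ℂ (X (blockIndex a (1 - c)) (blockIndex b d)) := by
      intro a b c d
      have := congr($h (blockIndex a c) (blockIndex b d))
      rw [mul_quaternionJ_apply, quaternionJ_mul_apply, Matrix.conjHom_apply] at this
      simpa only [blockSwap_blockIndex, blockIndex_mod_two] using this
    ext i j
    obtain ⟨a, c, rfl⟩ := exists_eq_blockIndex i
    obtain ⟨b, d, rfl⟩ := exists_eq_blockIndex j
    rw [epsH'Mat_blockIndex]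
    have h0 := key a b 1 0
    have h1 := key a b 1 1
    simp [Complex.ext_iff] at h0 h1
    fin_cases c <;> fin_cases d <;> simp [epsH', Complex.ext_iff, h0, h1] <;>
      exact ⟨rfl, rfl⟩

end Quaternion

/-- classification of irreducible ℝ-subalgebras of `Mₙ(ℂ)` according to the
smallest nonzero rank `r` present in the algebra. -/
theorem irreducible_real_subalgebra_of_complex_classification
    (n : ℕ) (hn : 1 ≤ n) (𝒜 : NonUnitalSubalgebra ℝ (Matrix (Fin n) (Fin n) ℂ))
    -- `𝒜` is irreducible
    (hne : (𝒜 : Set (Matrix (Fin n) (Fin n) ℂ)) ≠ {0})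
    (hirr : ∀ W : Submodule ℂ (Fin n → ℂ),
      (∀ A ∈ 𝒜, ∀ x ∈ W, A.mulVec x ∈ W) → W = ⊥ ∨ W = ⊤)
    -- `r` is the smallest nonzero rank present in `𝒜`
    (r : ℕ) (hr0 : r ≠ 0) (hrmem : ∃ A ∈ 𝒜, A.rank = r)
    (hrmin : ∀ A ∈ 𝒜, A.rank ≠ 0 → r ≤ A.rank) :
    r ∣ n ∧ (r = 1 ∨ r = 2) ∧
    (r = 1 → 𝒜 = ⊤ ∨ ∃ P : (Matrix (Fin n) (Fin n) ℂ)ˣ,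
      (fun X => (P⁻¹).val * X * P.val) '' (𝒜 : Set (Matrix (Fin n) (Fin n) ℂ)) =
        {X : Matrix (Fin n) (Fin n) ℂ | ∀ i j, (X i j).im = 0}) ∧
    (r = 2 → ∃ m : ℕ, ∃ h : n = 2 * m, ∃ P : (Matrix (Fin n) (Fin n) ℂ)ˣ,
      (fun X => (P⁻¹).val * X * P.val) '' (𝒜 : Set (Matrix (Fin n) (Fin n) ℂ)) =
        Set.range (fun A : Matrix (Fin m) (Fin m) (Quaternion ℝ) =>
          Matrix.reindex (finCongr h.symm) (finCongr h.symm) (epsH'Mat m A))) := by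
  have : Nonempty (Fin n) := ⟨⟨0, hn⟩⟩
  obtain ⟨A, hA, rfl⟩ := hrmem
  have hspan := Matrix.exists_add_I_smul_of_irreducible hne hirr
  have hle : ∀ X ∈ 𝒜, X ≠ 0 → A.rank ≤ X.rank := fun X hX hX0 =>
    hrmin X hX fun h => hX0 <| by
      rw [Matrix.rank, Submodule.finrank_eq_zero, LinearMap.range_eq_bot] at h
      exact Matrix.toLin'.injective (h.trans (map_zero _).symm)
  have hone : ∀ (P : (Matrix (Fin n) (Fin n) ℂ)ˣ),
      P.val * Matrix.single ⟨0, hn⟩ ⟨0, hn⟩ 1 * (P⁻¹).val ∈ 𝒜 → A.rank = 1 := by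
    intro P h
    refine le_antisymm ((hle _ h ?_).trans ?_) (Nat.one_le_iff_ne_zero.2 hr0)
    · rw [Ne, Units.mul_left_eq_zero, Units.mul_right_eq_zero]
      exact fun h => one_ne_zero (α := ℂ) (by simpa using congr($h ⟨0, hn⟩ ⟨0, hn⟩))
    · rw [Matrix.single_eq_single_vecMulVec_single]
      exact (Matrix.rank_mul_le_left _ _).trans
        ((Matrix.rank_mul_le_right _ _).trans (Matrix.rank_vecMulVec_le _ _))
  rcases Matrix.eq_top_or_forall_I_smul_mem hspan with htop | hdisj
  · have h1 : A.rank = 1 := hone 1 (htop ▸ NonUnitalAlgebra.mem_top)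
    rw [h1]
    exact ⟨one_dvd n, Or.inl rfl, fun _ => Or.inl htop, fun h => absurd h (by decide)⟩
  obtain ⟨S, ε, hε, hS, hmem⟩ := Matrix.exists_unit_mem_iff_mul_eq_mul_conjHom hspan hdisj
  rcases hε with rfl | rfl
  · obtain ⟨P, hP⟩ := Matrix.exists_unit_mul_conjHom_eq (Or.inl rfl) hS
      (J := 1) (by simp)
    have himage := Matrix.image_conj_eq (𝒜 := 𝒜) hmem hP
    have himage' : (fun X => (P⁻¹).val * X * P.val) '' (𝒜 : Set (Matrix (Fin n) (Fin n) ℂ)) =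
        {X : Matrix (Fin n) (Fin n) ℂ | ∀ i j, (X i j).im = 0} := by
      rw [himage]
      ext X
      simp [← Matrix.ext_iff, Matrix.conjHom_apply, eq_comm (a := X _ _), Complex.conj_eq_iff_im]
    have h1 : A.rank = 1 := by
      obtain ⟨X, hX, hX'⟩ := himage'.ge (show Matrix.single ⟨0, hn⟩ ⟨0, hn⟩ 1 ∈ _ by
        intro i j
        rw [Matrix.single_apply]
        split_ifs <;> simp)
      refine hone P (hX' ▸ ?_)
      simpa [mul_assoc] using hX
    rw [h1]
    exact ⟨one_dvd n, Or.inl rfl, fun _ => Or.inr ⟨P, himage'⟩, fun h => absurd h (by decide)⟩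
  · have hS' : S * Matrix.conjHom _ S = -1 := by simpa using hS
    have h2 : A.rank = 2 := by
      obtain ⟨X, hX, hX0, hX2⟩ := Matrix.exists_rank_le_two (Or.inr rfl) hS
      have h3 := (hle X ((hmem X).2 hX) hX0).trans hX2
      have h4 := Matrix.rank_ne_one_of_mul_eq_mul_conjHom hS' ((hmem A).1 hA)
      omega
    have heven := Matrix.even_card_of_mul_conjHom_eq_neg_one hS'
    rw [Fintype.card_fin] at heven
    rw [h2]
    refine ⟨heven.two_dvd, Or.inr rfl, fun h => absurd h (by decide), fun _ => ?_⟩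
    obtain ⟨m, rfl⟩ := heven.two_dvd
    obtain ⟨P, hP⟩ := Matrix.exists_unit_mul_conjHom_eq (Or.inr rfl) hS
      (J := quaternionJ m) (by simpa using quaternionJ_mul_conjHom m)
    refine ⟨m, rfl, P, ?_⟩
    rw [Matrix.image_conj_eq (𝒜 := 𝒜) hmem hP, ← range_epsH'Mat]
    rfl
end

section
/- Let n ≥ 1 and let S be an irreducible semigroup of triangularizable matrices in M_n(ℝ), and let φ : M_n(ℝ) → ℝ be a nonzero ℝ-linear functional. If the image φ(S) is a bounded subset of ℝ, then S is a bounded subset of M_n(ℝ). Consequently, S is bounded if and only if φ(S) is bounded. -/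
theorem Module.End.exists_hasEigenvalue_of_quadratic_injective {W : Type*} [AddCommGroup W]
    [Module ℝ W] [FiniteDimensional ℝ W] [Nontrivial W]
    (f : Module.End ℝ W)
    (hf : ∀ a b : ℝ, b ≠ 0 → ∀ v, f (f v) - (2 * a) • f v + (a ^ 2 + b ^ 2) • v = 0 → v = 0) :
    ∃ μ : ℝ, f.HasEigenvalue μ := by
  have hint : IsIntegral ℝ f := Algebra.IsIntegral.isIntegral f
  have hdeg : 0 < ((minpoly ℝ f).map (algebraMap ℝ ℂ)).degree := by
    rw [Polynomial.degree_map]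
    exact minpoly.degree_pos hint
  obtain ⟨z, hz⟩ := Complex.exists_root hdeg
  have hz' : Polynomial.aeval z (minpoly ℝ f) = 0 := by
    rwa [Polynomial.IsRoot, Polynomial.eval_map_algebraMap] at hz
  by_cases him : z.im = 0
  · refine ⟨z.re, Module.End.hasEigenvalue_of_isRoot ?_⟩
    have hzr : z = algebraMap ℝ ℂ z.re := by
      apply Complex.ext <;> simp [him]
    rw [hzr, Polynomial.aeval_algebraMap_apply] at hz'
    simpa using hz'
  · exfalso
    obtain ⟨s, hs⟩ := Polynomial.quadratic_dvd_of_aeval_eq_zero_im_ne_zero _ hz' him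
    have hmin : (minpoly ℝ f) ≠ 0 := minpoly.ne_zero hint
    have hs0 : s ≠ 0 := by
      rintro rfl
      simp [hmin] at hs
    have hsf : Polynomial.aeval f s = 0 := by
      ext w
      apply hf z.re z.im him
      have := congrArg (fun q => Polynomial.aeval f q w) hs
      simp only [minpoly.aeval, map_mul, Module.End.mul_apply] at this
      rw [Complex.sq_norm, Complex.normSq_apply, ← pow_two, ← pow_two] at this
      have hq := this.symm
      simp only [map_add, map_sub, map_mul, Polynomial.aeval_X, Polynomial.aeval_C,
        LinearMap.add_apply, LinearMap.sub_apply, Module.End.mul_apply, pow_two,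
        Module.algebraMap_end_apply, LinearMap.zero_apply] at hq
      simpa only [add_smul, mul_smul, pow_two] using hq
    have h1 := Polynomial.degree_le_of_dvd (minpoly.dvd ℝ f hsf) hs0
    rw [hs, Polynomial.degree_mul] at h1
    have h2 : (Polynomial.X ^ 2 - Polynomial.C (2 * z.re) * Polynomial.X +
        Polynomial.C (‖z‖ ^ 2)).degree = 2 := by
      compute_degree!
    rw [h2, Polynomial.degree_eq_natDegree hs0] at h1
    norm_cast at h1
    omega

namespace Matrix

/-- A real matrix has no nonreal eigenvalue if each quadratic polynomial with nonreal roots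
`a ± bi` gives an injective map when evaluated at it. -/
def HasNoNonrealEigenvalue {m : Type*} [Fintype m] (X : Matrix m m ℝ) : Prop :=
  ∀ a b : ℝ, b ≠ 0 → ∀ v, X *ᵥ (X *ᵥ v) - (2 * a) • X *ᵥ v + (a ^ 2 + b ^ 2) • v = 0 → v = 0

theorem sq_pow_le_det_of_triangularizable {n : ℕ} (X : Matrix (Fin n) (Fin n) ℝ)
    (h : ∃ P : (Matrix (Fin n) (Fin n) ℝ)ˣ,
      BlockTriangular
        ((↑P⁻¹ : Matrix (Fin n) (Fin n) ℝ) * X * (↑P : Matrix (Fin n) (Fin n) ℝ)) id) (a b : ℝ) :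
    (b ^ 2) ^ n ≤ (X * X - (2 * a) • X + (a ^ 2 + b ^ 2) • (1 : Matrix (Fin n) (Fin n) ℝ)).det := by
  obtain ⟨P, hP⟩ := h
  set D := (↑P⁻¹ : Matrix (Fin n) (Fin n) ℝ) * X * (↑P : Matrix (Fin n) (Fin n) ℝ) with hD
  have hconj : (↑P⁻¹ : Matrix (Fin n) (Fin n) ℝ) *
      (X * X - (2 * a) • X + (a ^ 2 + b ^ 2) • (1 : Matrix (Fin n) (Fin n) ℝ)) * P =
      D * D - (2 * a) • D + (a ^ 2 + b ^ 2) • (1 : Matrix (Fin n) (Fin n) ℝ) := by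
    have h1 : D * D = (↑P⁻¹ : Matrix (Fin n) (Fin n) ℝ) * (X * X) * P := by
      simp only [hD, mul_assoc, Units.mul_inv_cancel_left]
    rw [h1, hD]
    simp [mul_add, add_mul, mul_sub, sub_mul]
  have hdet : (X * X - (2 * a) • X + (a ^ 2 + b ^ 2) • (1 : Matrix (Fin n) (Fin n) ℝ)).det =
      (D * D - (2 * a) • D + (a ^ 2 + b ^ 2) • (1 : Matrix (Fin n) (Fin n) ℝ)).det := by
    rw [← hconj, det_units_conj']
  have htri : BlockTriangular
      (D * D - (2 * a) • D + (a ^ 2 + b ^ 2) • (1 : Matrix (Fin n) (Fin n) ℝ)) id :=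
    fun i j hij => by
      have hone : (1 : Matrix (Fin n) (Fin n) ℝ) i j = 0 := Matrix.one_apply_ne (ne_of_gt hij)
      simp [hP hij, (hP.mul hP) hij, hone]
  rw [hdet, det_of_isUpperTriangular htri]
  calc (b ^ 2) ^ n = ∏ _i : Fin n, b ^ 2 := by simp
    _ ≤ _ := by
      refine Finset.prod_le_prod (fun _ _ => sq_nonneg b) fun i _ => ?_
      have hii : (D * D) i i = D i i * D i i := by
        rw [Matrix.mul_apply]
        refine Finset.sum_eq_single i (fun j _ hj => ?_) (by simp)
        rcases lt_or_gt_of_ne hj with h | h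
        · rw [hP h, zero_mul]
        · rw [hP h, mul_zero]
      simp only [Matrix.add_apply, Matrix.sub_apply, Matrix.smul_apply, Matrix.one_apply_eq, hii,
        smul_eq_mul]
      nlinarith [sq_nonneg (D i i - a)]

theorem hasNoNonrealEigenvalue_of_sq_pow_le_det {n : ℕ} (X : Matrix (Fin n) (Fin n) ℝ)
    (h : ∀ a b : ℝ, (b ^ 2) ^ n ≤
      (X * X - (2 * a) • X + (a ^ 2 + b ^ 2) • (1 : Matrix (Fin n) (Fin n) ℝ)).det) :
    HasNoNonrealEigenvalue X := by
  intro a b hb v hv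
  refine Matrix.eq_zero_of_mulVec_eq_zero
    (M := X * X - (2 * a) • X + (a ^ 2 + b ^ 2) • (1 : Matrix (Fin n) (Fin n) ℝ))
    (ne_of_gt (lt_of_lt_of_le (by positivity) (h a b))) ?_
  rw [← hv]
  simp [add_mulVec, sub_mulVec, smul_mulVec]

theorem exists_rank_factorization {K : Type*} [Field K] {m n : Type*} [Fintype n]
    (A : Matrix m n K) :
    ∃ (G : Matrix m (Fin A.rank) K) (H : Matrix (Fin A.rank) n K), G * H = A := by
  classical
  let e : LinearMap.range A.mulVecLin ≃ₗ[K] (Fin A.rank → K) :=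
    (Module.finBasisOfFinrankEq K (LinearMap.range A.mulVecLin) rfl).equivFun
  refine ⟨LinearMap.toMatrix' ((LinearMap.range A.mulVecLin).subtype ∘ₗ e.symm.toLinearMap),
    LinearMap.toMatrix' (e.toLinearMap ∘ₗ A.mulVecLin.rangeRestrict), ?_⟩
  rw [← LinearMap.toMatrix'_comp]
  have hcomp : ((LinearMap.range A.mulVecLin).subtype ∘ₗ e.symm.toLinearMap) ∘ₗ
      (e.toLinearMap ∘ₗ A.mulVecLin.rangeRestrict) = Matrix.toLin' A := by
    ext1
    ext1
    simp
  rw [hcomp, LinearMap.toMatrix'_toLin']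

section
open scoped Matrix.Norms.Operator

theorem mul_self_eq_one_of_mem_isCompact {r : ℕ} {K : Set (Matrix (Fin r) (Fin r) ℝ)}
    (hK : IsCompact K)
    (hmul : ∀ A ∈ K, ∀ B ∈ K, A * B ∈ K) (hdet : ∀ A ∈ K, |A.det| = 1)
    {g : Matrix (Fin r) (Fin r) ℝ} (hg : g ∈ K) (hreal : HasNoNonrealEigenvalue g) : g * g = 1 := by
  obtain ⟨C₁, hC₁⟩ := hK.exists_bound_of_continuousOn (f := fun A => A) continuousOn_id
  obtain ⟨C₂, hC₂⟩ := hK.exists_bound_of_continuousOn (f := fun A => A.adjugate)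
    (continuous_id.matrix_adjugate).continuousOn
  have hupper : ∀ A ∈ K, ∀ v, ‖A *ᵥ v‖ ≤ C₁ * ‖v‖ := fun A hA v =>
    (linfty_opNorm_mulVec A v).trans
      (mul_le_mul_of_nonneg_right (hC₁ A hA) (norm_nonneg v))
  have hlower : ∀ A ∈ K, ∀ v, ‖v‖ ≤ C₂ * ‖A *ᵥ v‖ := fun A hA v => by
    have h1 : A.adjugate *ᵥ (A *ᵥ v) = A.det • v := by
      rw [mulVec_mulVec, Matrix.adjugate_mul, smul_mulVec, one_mulVec]
    have h2 : ‖A.det • v‖ = ‖v‖ := by rw [norm_smul, Real.norm_eq_abs, hdet A hA, one_mul]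
    rw [← h2, ← h1]
    exact (linfty_opNorm_mulVec _ _).trans
      (mul_le_mul_of_nonneg_right (hC₂ A hA) (norm_nonneg _))
  have hpow : ∀ k : ℕ, g ^ (k + 1) ∈ K := by
    intro k
    induction k with
    | zero => simpa using hg
    | succ k ih => exact pow_succ g (k + 1) ▸ hmul _ ih _ hg
  by_contra hne
  set f : Module.End ℝ (Fin r → ℝ) := g.mulVecLin with hf
  set h : Module.End ℝ (Fin r → ℝ) := (g * g - 1).mulVecLin with hh
  have hinv : ∀ v ∈ LinearMap.range h, f v ∈ LinearMap.range h := by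
    rintro _ ⟨w, rfl⟩
    refine ⟨f w, ?_⟩
    simp only [hh, hf, mulVecLin_apply, mulVec_mulVec]
    congr 1
    noncomm_ring
  have hnt : Nontrivial (LinearMap.range h) := by
    rw [Submodule.nontrivial_iff_ne_bot, Ne, LinearMap.range_eq_bot]
    intro h0
    apply hne
    rw [← sub_eq_zero]
    apply mulVec_injective
    ext1 v
    rw [zero_mulVec]
    exact LinearMap.congr_fun h0 v
  obtain ⟨μ, hμ⟩ := Module.End.exists_hasEigenvalue_of_quadratic_injective
    (f.restrict hinv) (fun a b hb v hv => by
    apply Subtype.ext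
    exact hreal a b hb v (by simpa [hf] using congrArg Subtype.val hv))
  obtain ⟨⟨_, w, rfl⟩, hv⟩ := hμ.exists_hasEigenvector
  have hv0 : h w ≠ 0 := fun h0 => hv.2 (Subtype.ext h0)
  have hgv : g *ᵥ (h w) = μ • h w := congrArg Subtype.val hv.apply_eq_smul
  generalize hvdef : h w = v at hv0 hgv
  have hvw : g *ᵥ (g *ᵥ w) = w + v := by
    rw [← hvdef, hh, mulVecLin_apply, sub_mulVec, one_mulVec,
      mulVec_mulVec, add_sub_cancel]
  have hpv : ∀ k : ℕ, g ^ k *ᵥ v = μ ^ k • v := by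
    intro k
    induction k with
    | zero => simp
    | succ k ih => rw [pow_succ, ← mulVec_mulVec, hgv, mulVec_smul, ih, smul_smul,
        pow_succ']
  have hvpos : 0 < ‖v‖ := norm_pos_iff.2 hv0
  have hμ1 : |μ| = 1 := by
    apply le_antisymm
    · by_contra! hlt
      obtain ⟨k, hk⟩ := pow_unbounded_of_one_lt C₁ hlt
      have h1 := hupper _ (hpow k) v
      rw [hpv, norm_smul, norm_pow, Real.norm_eq_abs] at h1
      have h2 := le_of_mul_le_mul_right h1 hvpos
      have h3 : |μ| ^ k ≤ |μ| ^ (k + 1) := pow_le_pow_right₀ hlt.le (Nat.le_succ k)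
      linarith
    · by_contra! hlt
      have hC₂pos : 0 < C₂ := by
        by_contra! hle
        have := hlower g hg v
        nlinarith [norm_nonneg (g *ᵥ v)]
      obtain ⟨k, hk⟩ := exists_pow_lt_of_lt_one (inv_pos.2 hC₂pos) hlt
      have h1 := hlower _ (hpow k) v
      rw [hpv, norm_smul, norm_pow, Real.norm_eq_abs, ← mul_assoc] at h1
      have h2 : 1 ≤ C₂ * |μ| ^ (k + 1) := by
        by_contra! h
        nlinarith
      have h3 : |μ| ^ (k + 1) ≤ |μ| ^ k :=
        pow_le_pow_of_le_one (abs_nonneg μ) hlt.le (Nat.le_succ k)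
      have h4 : C₂ * |μ| ^ k < 1 := by
        rwa [← one_div, lt_div_iff₀' hC₂pos] at hk
      nlinarith
  have hμ2 : μ ^ 2 = 1 := by rw [← sq_abs, hμ1, one_pow]
  have hpw : ∀ k : ℕ, g ^ (2 * k) *ᵥ w = w + (k : ℝ) • v := by
    intro k
    induction k with
    | zero => simp
    | succ k ih =>
      rw [mul_add, pow_add, mul_one, pow_two, ← mulVec_mulVec, ← mulVec_mulVec, hvw,
        mulVec_add, ih, hpv, pow_mul, hμ2, one_pow, one_smul, Nat.cast_succ, add_smul,
        one_smul, add_assoc]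
  obtain ⟨k, hk⟩ := exists_nat_gt ((C₁ * ‖w‖ + ‖w‖) / ‖v‖)
  rw [div_lt_iff₀ hvpos] at hk
  have h1 := hupper _ (hpow (2 * k + 1)) w
  rw [show 2 * k + 1 + 1 = 2 * (k + 1) by ring, hpw] at h1
  have h2 : ‖((k + 1 : ℕ) : ℝ) • v‖ ≤ ‖w + ((k + 1 : ℕ) : ℝ) • v‖ + ‖w‖ := by
    have := norm_sub_le (w + ((k + 1 : ℕ) : ℝ) • v) w
    rwa [add_sub_cancel_left] at this
  rw [norm_smul, Real.norm_natCast] at h2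
  push_cast at h1 h2
  nlinarith

theorem commute_and_one_mem_of_isClosed_cone {r : ℕ} (hr : r ≠ 0)
    {L : Set (Matrix (Fin r) (Fin r) ℝ)} (hcl : IsClosed L)
    (hmul : ∀ A ∈ L, ∀ B ∈ L, A * B ∈ L) (hsmul : ∀ c : ℝ, 0 ≤ c → ∀ A ∈ L, c • A ∈ L)
    (hdet : ∀ A ∈ L, A ≠ 0 → A.det ≠ 0) (hreal : ∀ A ∈ L, HasNoNonrealEigenvalue A) :
    (∀ A ∈ L, ∀ B ∈ L, A * B = B * A) ∧ ((∃ A ∈ L, A ≠ 0) → 1 ∈ L) := by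
  have hdetc : Continuous fun A : Matrix (Fin r) (Fin r) ℝ => |A.det| :=
    (continuous_id.matrix_det).abs
  obtain ⟨δ, hδ, hmin⟩ : ∃ δ : ℝ, 0 < δ ∧ ∀ A ∈ L ∩ Metric.sphere 0 1, δ ≤ |A.det| := by
    refine IsCompact.exists_forall_le' (((isCompact_sphere _ _).inter_left hcl))
      hdetc.continuousOn fun A hA => abs_pos.2 (hdet A hA.1 ?_)
    rintro rfl
    simpa using hA.2
  set K : Set (Matrix (Fin r) (Fin r) ℝ) := L ∩ {A | |A.det| = 1}
  have hKbound : ∀ A ∈ K, ‖A‖ ≤ max 1 δ⁻¹ := by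
    rintro A ⟨hA, hA1⟩
    rcases le_or_gt ‖A‖ 1 with h | h
    · exact h.trans (le_max_left _ _)
    · have hpos : 0 < ‖A‖ := zero_lt_one.trans h
      have h1 := hmin (‖A‖⁻¹ • A) ⟨hsmul _ (by positivity) _ hA, by
        simp [norm_smul, hpos.ne']⟩
      rw [det_smul, Fintype.card_fin, abs_mul, hA1, mul_one, abs_of_pos (by positivity)] at h1
      have h2 : ‖A‖⁻¹ ^ r ≤ ‖A‖⁻¹ :=
        pow_le_of_le_one (by positivity) (inv_le_one_of_one_le₀ h.le) hr
      exact ((le_inv_comm₀ hδ hpos).1 (h1.trans h2)).trans (le_max_right _ _)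
  have hK : IsCompact K := by
    refine Metric.isCompact_of_isClosed_isBounded
      (hcl.inter (isClosed_singleton.preimage hdetc)) ?_
    exact (Metric.isBounded_closedBall (x := 0) (r := max 1 δ⁻¹)).subset fun A hA => by
      simpa using hKbound A hA
  have hKmul : ∀ A ∈ K, ∀ B ∈ K, A * B ∈ K := fun A hA B hB => ⟨hmul _ hA.1 _ hB.1, by
    have h1 : |A.det| = 1 := hA.2
    have h2 : |B.det| = 1 := hB.2
    simp [abs_mul, h1, h2]⟩
  have hsq : ∀ A ∈ K, A * A = 1 := fun A hA =>
    mul_self_eq_one_of_mem_isCompact hK hKmul (fun B hB => hB.2) hA (hreal A hA.1)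
  have hKcomm : ∀ A ∈ K, ∀ B ∈ K, A * B = B * A := fun A hA B hB => by
    have h := hsq _ (hKmul A hA B hB)
    calc A * B = A * ((A * B) * (A * B)) * B := by rw [h, mul_one]
      _ = (A * A) * (B * A) * (B * B) := by simp only [mul_assoc]
      _ = B * A := by rw [hsq A hA, hsq B hB, one_mul, mul_one]
  have hscale : ∀ A ∈ L, A ≠ 0 → ∃ c : ℝ, c ≠ 0 ∧ c • A ∈ K := fun A hA hA0 => by
    have hpos : 0 < |A.det| := abs_pos.2 (hdet A hA hA0)
    have hc : 0 < |A.det|⁻¹ ^ ((r : ℝ)⁻¹) := by positivity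
    refine ⟨_, hc.ne', hsmul _ hc.le _ hA, ?_⟩
    rw [Set.mem_ofPred_eq, det_smul, Fintype.card_fin,
      Real.rpow_inv_natCast_pow (by positivity) hr, abs_mul, abs_inv, abs_abs,
      inv_mul_cancel₀ hpos.ne']
  constructor
  · intro A hA B hB
    rcases eq_or_ne A 0 with rfl | hA0
    · simp
    rcases eq_or_ne B 0 with rfl | hB0
    · simp
    obtain ⟨c, hc, hcA⟩ := hscale A hA hA0
    obtain ⟨d, hd, hdB⟩ := hscale B hB hB0
    have h := hKcomm _ hcA _ hdB
    rw [Matrix.smul_mul, Matrix.mul_smul, Matrix.smul_mul, Matrix.mul_smul, smul_comm d c] at h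
    exact smul_right_injective _ hd (smul_right_injective _ hc h)
  · rintro ⟨A, hA, hA0⟩
    obtain ⟨c, -, hcA⟩ := hscale A hA hA0
    exact hsq _ hcA ▸ (hKmul _ hcA _ hcA).1
end

theorem exists_mem_span_mulVec_eq {n : ℕ} {S : Set (Matrix (Fin n) (Fin n) ℝ)}
    (hmul : ∀ A ∈ S, ∀ B ∈ S, A * B ∈ S) (hne : ∃ A ∈ S, A ≠ 0)
    (hirr : ∀ W : Submodule ℝ (Fin n → ℝ),
      (∀ A ∈ S, ∀ x ∈ W, A.mulVec x ∈ W) → W = ⊥ ∨ W = ⊤)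
    {u : Fin n → ℝ} (hu : u ≠ 0) (w : Fin n → ℝ) : ∃ X ∈ Submodule.span ℝ S, X *ᵥ u = w := by
  let ev : Matrix (Fin n) (Fin n) ℝ →ₗ[ℝ] (Fin n → ℝ) := (mulVecBilin ℝ ℝ).flip u
  have hinv : ∀ A ∈ S, ∀ x ∈ (Submodule.span ℝ S).map ev, A *ᵥ x ∈ (Submodule.span ℝ S).map ev := by
    rintro A hA _ ⟨X, hX, rfl⟩
    refine ⟨A * X, ?_, (mulVec_mulVec u A X).symm⟩
    have hX' : X ∈ Submodule.span ℝ S := hX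
    clear hX
    induction hX' using Submodule.span_induction with
    | mem X hX => exact Submodule.subset_span (hmul _ hA _ hX)
    | zero => simp
    | add X Y _ _ h₁ h₂ => rw [Matrix.mul_add]; exact add_mem h₁ h₂
    | smul c X _ h₁ => rw [Matrix.mul_smul]; exact Submodule.smul_mem _ c h₁
  rcases hirr _ hinv with h | h
  · exfalso
    have hker : ∀ A ∈ S, A *ᵥ u = 0 := fun A hA => by
      have : ev A ∈ (Submodule.span ℝ S).map ev :=
        Submodule.mem_map_of_mem (Submodule.subset_span hA)
      rwa [h, Submodule.mem_bot] at this
    obtain ⟨B, hB, hB0⟩ := hne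
    have hker_inv : ∀ A ∈ S, ∀ x ∈ ⨅ A ∈ S, LinearMap.ker A.mulVecLin,
        A *ᵥ x ∈ ⨅ A ∈ S, LinearMap.ker A.mulVecLin := by
      intro A hA x hx
      simp only [Submodule.mem_iInf, LinearMap.mem_ker, mulVecLin_apply] at hx ⊢
      intro B hB
      rw [hx A hA, mulVec_zero]
    rcases hirr _ hker_inv with h' | h'
    · apply hu
      rw [← Submodule.mem_bot ℝ, ← h']
      simpa using hker
    · apply hB0
      apply mulVec_injective
      ext1 v
      have hv : v ∈ ⨅ A ∈ S, LinearMap.ker A.mulVecLin := h' ▸ Submodule.mem_top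
      simp only [Submodule.mem_iInf, LinearMap.mem_ker, mulVecLin_apply] at hv
      rw [hv B hB, zero_mulVec]
  · have hw : w ∈ (Submodule.span ℝ S).map ev := h ▸ Submodule.mem_top
    obtain ⟨X, hX, hXw⟩ := hw
    exact ⟨X, hX, hXw⟩

theorem eq_top_of_vecMulVec_mem {n : ℕ} {M : Submodule ℝ (Matrix (Fin n) (Fin n) ℝ)}
    (hmul : ∀ A ∈ M, ∀ B ∈ M, A * B ∈ M)
    (htrans : ∀ u : Fin n → ℝ, u ≠ 0 → ∀ w, ∃ X ∈ M, X *ᵥ u = w)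
    {p f : Fin n → ℝ} (hpf : vecMulVec p f ∈ M) (hne : vecMulVec p f ≠ 0) : M = ⊤ := by
  have hp : p ≠ 0 := by rintro rfl; simp at hne
  have hf : f ≠ 0 := by rintro rfl; simp at hne
  let ev : Matrix (Fin n) (Fin n) ℝ →ₗ[ℝ] (Fin n → ℝ) := (vecMulBilin ℝ ℝ) f
  have hev : ∀ X, ev X = f ᵥ* X := fun X => rfl
  have htop : M.map ev = ⊤ := by
    by_contra hcon
    obtain ⟨ψ, hψ0, hψ⟩ := Submodule.exists_le_ker_of_lt_top _ (lt_top_iff_ne_top.2 hcon)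
    obtain ⟨v, rfl⟩ := (dotProductEquiv ℝ (Fin n)).surjective ψ
    have hv : v ≠ 0 := by rintro rfl; simp at hψ0
    apply hf
    ext i
    obtain ⟨X, hX, hXv⟩ := htrans v hv (Pi.single i 1)
    have h := hψ (Submodule.mem_map_of_mem (f := ev) hX)
    rw [LinearMap.mem_ker, hev, dotProductEquiv_apply_apply, dotProduct_comm,
      ← Matrix.dotProduct_mulVec, hXv] at h
    simpa using h
  have hall : ∀ w g : Fin n → ℝ, vecMulVec w g ∈ M := by
    intro w g
    obtain ⟨X, hX, rfl⟩ := htrans p hp w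
    have hg : g ∈ M.map ev := htop ▸ Submodule.mem_top
    obtain ⟨Y, hY, rfl⟩ := hg
    have := hmul _ (hmul _ hX _ hpf) _ hY
    rwa [mul_vecMulVec, vecMulVec_mul] at this
  rw [eq_top_iff]
  intro A _
  rw [Matrix.matrix_eq_sum_single A]
  refine sum_mem fun i _ => sum_mem fun j _ => ?_
  rw [← mul_one (A i j), ← smul_eq_mul, ← Matrix.smul_single,
    single_eq_single_vecMulVec_single]
  exact Submodule.smul_mem _ _ (hall _ _)

theorem HasNoNonrealEigenvalue.of_mul_mul {n r : ℕ} {G : Matrix (Fin n) (Fin r) ℝ}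
    {F : Matrix (Fin r) (Fin n) ℝ}
    (hFG : F * G = 1) {Y : Matrix (Fin r) (Fin r) ℝ} (h : HasNoNonrealEigenvalue (G * Y * F)) :
    HasNoNonrealEigenvalue Y := by
  intro a b hb v hv
  have hGv : ∀ v, (G * Y * F) *ᵥ (G *ᵥ v) = G *ᵥ (Y *ᵥ v) := fun v => by
    rw [mulVec_mulVec, Matrix.mul_assoc, hFG, Matrix.mul_one, mulVec_mulVec]
  have h0 := h a b hb (G *ᵥ v) (by
    rw [← mulVec_zero G, ← hv, hGv, hGv, mulVec_add, mulVec_sub,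
      mulVec_smul, mulVec_smul])
  rw [← one_mulVec v, ← hFG, ← mulVec_mulVec, h0, mulVec_zero]

theorem exists_vecMulVec_mem_of_isClosed_cone {n : ℕ} {T : Set (Matrix (Fin n) (Fin n) ℝ)}
    (hcl : IsClosed T)
    (hmul : ∀ A ∈ T, ∀ B ∈ T, A * B ∈ T) (hsmul : ∀ c : ℝ, 0 ≤ c → ∀ A ∈ T, c • A ∈ T)
    (hreal : ∀ A ∈ T, HasNoNonrealEigenvalue A) (hne : ∃ A ∈ T, A ≠ 0)
    (htrans : ∀ u : Fin n → ℝ, u ≠ 0 → ∀ w, ∃ X ∈ Submodule.span ℝ T, X *ᵥ u = w) :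
    ∃ p f : Fin n → ℝ, vecMulVec p f ∈ T ∧ vecMulVec p f ≠ 0 := by
  obtain ⟨A, ⟨hA, hA0⟩, hmin⟩ := WellFounded.has_min
    (measure (rank : Matrix (Fin n) (Fin n) ℝ → ℕ)).wf
    {A | A ∈ T ∧ A ≠ 0} hne
  have hmin' : ∀ B ∈ T, B ≠ 0 → A.rank ≤ B.rank := fun B hB hB0 => not_lt.1 (hmin B ⟨hB, hB0⟩)
  have hr : A.rank ≠ 0 := by
    intro h
    apply hA0
    rw [rank, Submodule.finrank_eq_zero, LinearMap.range_eq_bot] at h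
    apply mulVec_injective
    ext1 v
    rw [zero_mulVec]
    exact LinearMap.congr_fun h v
  obtain ⟨X, hX, hAXA⟩ : ∃ X ∈ T, A * X * A ≠ 0 := by
    by_contra! hcon
    have hcon' : ∀ X ∈ Submodule.span ℝ T, A * X * A = 0 := by
      intro X hX
      induction hX using Submodule.span_induction with
      | mem X hX => exact hcon X hX
      | zero => simp
      | add X Y _ _ h₁ h₂ => rw [mul_add, add_mul, h₁, h₂, add_zero]
      | smul c X _ h₁ => rw [Matrix.mul_smul, Matrix.smul_mul, h₁, smul_zero]
    apply hA0
    apply mulVec_injective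
    ext1 u
    rw [zero_mulVec]
    by_contra hu
    obtain ⟨X, hX, hXu⟩ := htrans _ hu u
    have := congrArg (· *ᵥ u) (hcon' X hX)
    simp only [← mulVec_mulVec, hXu, zero_mulVec] at this
    exact hu this
  obtain ⟨G, H, hGH⟩ := exists_rank_factorization A
  generalize A.rank = r at G H hGH hr hmin'
  have hunit : ∀ (Y : Matrix (Fin r) (Fin r) ℝ) (F : Matrix (Fin r) (Fin n) ℝ),
      G * Y * F ∈ T → G * Y * F ≠ 0 → IsUnit Y := by
    intro Y F hT h0
    have h1 : r ≤ Y.rank :=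
      (hmin' _ hT h0).trans ((rank_mul_le_left _ _).trans (rank_mul_le_right _ _))
    rw [← mulVec_surjective_iff_isUnit]
    have h2 : LinearMap.range Y.mulVecLin = ⊤ := by
      apply Submodule.eq_top_of_finrank_eq
      rw [Module.finrank_fin_fun]
      exact le_antisymm (rank_le_width Y) h1
    exact LinearMap.range_eq_top.1 h2
  have hAXA' : G * (H * X * G) * H = A * X * A := by
    rw [← hGH]; simp only [Matrix.mul_assoc]
  have hZ : IsUnit (H * X * G) :=
    hunit _ H (hAXA' ▸ hmul _ (hmul _ hA _ hX) _ hA) (hAXA' ▸ hAXA)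
  obtain ⟨F, hFG, hFX⟩ : ∃ F : Matrix (Fin r) (Fin n) ℝ, F * G = 1 ∧ (H * X * G) * F = H * X := by
    rw [Matrix.isUnit_iff_isUnit_det] at hZ
    refine ⟨(H * X * G)⁻¹ * (H * X), ?_, Matrix.mul_nonsing_inv_cancel_left _ _ hZ⟩
    rw [Matrix.mul_assoc, nonsing_inv_mul _ hZ]
  have hexpand : ∀ Y : Matrix (Fin r) (Fin r) ℝ, F * (G * Y * F) * G = Y := fun Y => by
    rw [Matrix.mul_assoc G Y F, ← Matrix.mul_assoc F G, hFG, Matrix.one_mul, Matrix.mul_assoc, hFG,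
      Matrix.mul_one]
  set L : Set (Matrix (Fin r) (Fin r) ℝ) := {Y | G * Y * F ∈ T} with hL
  have hrnt : Nonempty (Fin r) := ⟨⟨0, Nat.pos_of_ne_zero hr⟩⟩
  obtain ⟨hcomm, hone⟩ := commute_and_one_mem_of_isClosed_cone (L := L) hr
    (hcl.preimage ((continuous_const.matrix_mul continuous_id).matrix_mul continuous_const))
    (fun Y hY Y' hY' => by
      have := hmul _ hY _ hY'
      rwa [show G * Y * F * (G * Y' * F) = G * (Y * (F * G) * Y') * F by
        simp only [Matrix.mul_assoc], hFG, mul_one] at this)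
    (fun c hc Y hY => by
      have := hsmul c hc _ hY
      rwa [← Matrix.smul_mul, ← Matrix.mul_smul] at this)
    (fun Y hY hY0 => by
      refine ((Matrix.isUnit_iff_isUnit_det _).1 (hunit Y F hY fun h => hY0 ?_)).ne_zero
      rw [← hexpand Y, h, Matrix.mul_zero, Matrix.zero_mul])
    (fun Y hY => HasNoNonrealEigenvalue.of_mul_mul hFG (hreal _ hY))
  have hGF : G * F ∈ T := by
    have h1 : (1 : Matrix (Fin r) (Fin r) ℝ) ∈ L := by
      refine hone ⟨H * X * G, ?_, hZ.ne_zero⟩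
      rw [hL, Set.mem_ofPred_eq, Matrix.mul_assoc, hFX, ← Matrix.mul_assoc, hGH]
      exact hmul _ hA _ hX
    rwa [hL, Set.mem_ofPred_eq, Matrix.mul_one] at h1
  have hmem : ∀ X ∈ T, F * X * G ∈ L := fun X hX => by
    have := hmul _ (hmul _ hGF _ hX) _ hGF
    rw [hL, Set.mem_ofPred_eq]
    simpa only [Matrix.mul_assoc] using this
  have htransL : ∀ u : Fin r → ℝ, u ≠ 0 → ∀ w, ∃ X ∈ Submodule.span ℝ T, (F * X * G) *ᵥ u = w := by
    intro u hu w
    have hFGv : ∀ v, F *ᵥ (G *ᵥ v) = v := fun v => by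
      rw [mulVec_mulVec, hFG, one_mulVec]
    obtain ⟨X, hX, hXu⟩ := htrans (G *ᵥ u) (fun h => hu (by
      rw [← hFGv u, h, mulVec_zero])) (G *ᵥ w)
    refine ⟨X, hX, ?_⟩
    rw [← mulVec_mulVec, ← mulVec_mulVec, hXu, hFGv]
  have hcommM : ∀ Y ∈ L, ∀ X ∈ Submodule.span ℝ T, Y * (F * X * G) = (F * X * G) * Y := by
    intro Y hY X hX
    induction hX using Submodule.span_induction with
    | mem X hX => exact hcomm _ hY _ (hmem X hX)
    | zero => simp
    | add X Y _ _ h₁ h₂ => simp only [Matrix.mul_add, Matrix.add_mul, h₁, h₂]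
    | smul c X _ h₁ => simp only [Matrix.mul_smul, Matrix.smul_mul, h₁]
  have hscal : ∀ Y ∈ L, ∃ μ : ℝ, ∀ v, Y *ᵥ v = μ • v := by
    intro Y hY
    obtain ⟨μ, hμ⟩ := Module.End.exists_hasEigenvalue_of_quadratic_injective Y.mulVecLin
      (HasNoNonrealEigenvalue.of_mul_mul hFG (hreal _ hY))
    obtain ⟨u, hu⟩ := hμ.exists_hasEigenvector
    refine ⟨μ, fun v => ?_⟩
    obtain ⟨X, hX, rfl⟩ := htransL u hu.2 v
    have hYu : Y *ᵥ u = μ • u := hu.apply_eq_smul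
    rw [mulVec_mulVec, hcommM Y hY X hX, ← mulVec_mulVec, hYu, mulVec_smul]
  have hscalM : ∀ X ∈ Submodule.span ℝ T, ∃ μ : ℝ, ∀ v, (F * X * G) *ᵥ v = μ • v := by
    intro X hX
    induction hX using Submodule.span_induction with
    | mem X hX => exact hscal _ (hmem X hX)
    | zero => exact ⟨0, by simp⟩
    | add X Y _ _ h₁ h₂ =>
      obtain ⟨μ, hμ⟩ := h₁
      obtain ⟨ν, hν⟩ := h₂
      exact ⟨μ + ν, fun v => by rw [Matrix.mul_add, Matrix.add_mul, add_mulVec, hμ, hν, add_smul]⟩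
    | smul c X _ h₁ =>
      obtain ⟨μ, hμ⟩ := h₁
      exact ⟨c * μ, fun v => by rw [Matrix.mul_smul, Matrix.smul_mul, smul_mulVec, hμ, mul_smul]⟩
  obtain ⟨u, hu⟩ := exists_ne (0 : Fin r → ℝ)
  have hline : ∀ w : Fin r → ℝ, ∃ c : ℝ, w = c • u := fun w => by
    obtain ⟨X, hX, rfl⟩ := htransL u hu w
    obtain ⟨μ, hμ⟩ := hscalM X hX
    exact ⟨μ, hμ u⟩
  choose f hf using fun j : Fin n => hline (F.col j)
  have hFeq : F = vecMulVec u f := by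
    ext i j
    have := congrFun (hf j) i
    simpa [vecMulVec_apply, mul_comm] using this
  have hGFeq : G * F = vecMulVec (G *ᵥ u) f := by rw [hFeq, mul_vecMulVec]
  refine ⟨G *ᵥ u, f, hGFeq ▸ hGF, hGFeq ▸ fun h => ?_⟩
  have h1 := hexpand 1
  rw [Matrix.mul_one, h, Matrix.mul_zero, Matrix.zero_mul] at h1
  exact zero_ne_one h1

theorem span_eq_top_of_irreducible_of_triangularizable {n : ℕ} {S : Set (Matrix (Fin n) (Fin n) ℝ)}
    (hmul : ∀ A ∈ S, ∀ B ∈ S, A * B ∈ S)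
    (htri : ∀ A ∈ S, ∃ P : (Matrix (Fin n) (Fin n) ℝ)ˣ,
      BlockTriangular
        ((↑P⁻¹ : Matrix (Fin n) (Fin n) ℝ) * A * (↑P : Matrix (Fin n) (Fin n) ℝ)) id)
    (hne : ∃ A ∈ S, A ≠ 0)
    (hirr : ∀ W : Submodule ℝ (Fin n → ℝ),
      (∀ A ∈ S, ∀ x ∈ W, A.mulVec x ∈ W) → W = ⊥ ∨ W = ⊤) : Submodule.span ℝ S = ⊤ := by
  have htrans := fun u hu w => exists_mem_span_mulVec_eq hmul hne hirr (u := u) hu w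
  set C : Set (Matrix (Fin n) (Fin n) ℝ) := {X | ∃ c : ℝ, 0 ≤ c ∧ ∃ A ∈ S, X = c • A}
  have hSC : S ⊆ closure C := fun A hA =>
    subset_closure ⟨1, zero_le_one, A, hA, (one_smul _ _).symm⟩
  have hCspan : closure C ⊆ Submodule.span ℝ S := by
    refine closure_minimal ?_ (Submodule.closed_of_finiteDimensional _)
    rintro _ ⟨c, -, A, hA, rfl⟩
    exact Submodule.smul_mem _ c (Submodule.subset_span hA)
  have hspan : Submodule.span ℝ S = Submodule.span ℝ (closure C) :=
    le_antisymm (Submodule.span_mono hSC) (Submodule.span_le.2 hCspan)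
  obtain ⟨A₀, hA₀, hA₀0⟩ := hne
  obtain ⟨p, f, hpf, hpf0⟩ := exists_vecMulVec_mem_of_isClosed_cone (T := closure C)
    isClosed_closure
    (fun A hA B hB => by
      refine map_mem_closure₂ continuous_mul hA hB ?_
      rintro _ ⟨c, hc, A, hA, rfl⟩ _ ⟨d, hd, B, hB, rfl⟩
      exact ⟨c * d, mul_nonneg hc hd, A * B, hmul _ hA _ hB, by
        rw [Matrix.smul_mul, Matrix.mul_smul, smul_smul]⟩)
    (fun c hc A hA => by
      refine map_mem_closure (continuous_const_smul c) hA ?_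
      rintro _ ⟨d, hd, A, hA, rfl⟩
      exact ⟨c * d, mul_nonneg hc hd, A, hA, smul_smul _ _ _⟩)
    (fun A hA => hasNoNonrealEigenvalue_of_sq_pow_le_det A fun a b => by
      have hcl : IsClosed {X : Matrix (Fin n) (Fin n) ℝ | (b ^ 2) ^ n ≤
          (X * X - (2 * a) • X + (a ^ 2 + b ^ 2) • (1 : Matrix (Fin n) (Fin n) ℝ)).det} :=
        isClosed_le continuous_const (Continuous.matrix_det (by fun_prop))
      refine closure_minimal ?_ hcl hA
      rintro _ ⟨c, -, A, hA, rfl⟩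
      refine sq_pow_le_det_of_triangularizable _ ?_ a b
      obtain ⟨P, hP⟩ := htri A hA
      refine ⟨P, fun i j hij => ?_⟩
      rw [Matrix.mul_smul, Matrix.smul_mul, Matrix.smul_apply, hP hij, smul_zero])
    ⟨A₀, hSC hA₀, hA₀0⟩ (fun u hu w => hspan ▸ htrans u hu w)
  refine eq_top_of_vecMulVec_mem (fun A hA B hB => ?_) htrans (hCspan hpf) hpf0
  have h := Submodule.mul_mem_mul hA hB
  rw [Submodule.span_mul_span] at h
  refine Submodule.span_mono ?_ h
  rintro _ ⟨A, hA, B, hB, rfl⟩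
  exact hmul A hA B hB

theorem bounded_entries_of_bounded_linearMap {n : ℕ} (S : Set (Matrix (Fin n) (Fin n) ℝ))
    (hmul : ∀ A ∈ S, ∀ B ∈ S, A * B ∈ S) (hspan : Submodule.span ℝ S = ⊤)
    (φ : Matrix (Fin n) (Fin n) ℝ →ₗ[ℝ] ℝ) (hφ : φ ≠ 0) (h : ∃ C : ℝ, ∀ A ∈ S, |φ A| ≤ C) :
    ∃ C : ℝ, ∀ A ∈ S, ∀ i j, |A i j| ≤ C := by
  have key : ∀ X Y : Matrix (Fin n) (Fin n) ℝ, ∃ C : ℝ, ∀ A ∈ S, |φ (X * A * Y)| ≤ C := by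
    intro X Y
    have hX : X ∈ Submodule.span ℝ S := hspan ▸ Submodule.mem_top
    have hY : Y ∈ Submodule.span ℝ S := hspan ▸ Submodule.mem_top
    induction hX, hY using Submodule.span_induction₂ with
    | mem_mem X Y hX hY =>
      obtain ⟨C, hC⟩ := h
      exact ⟨C, fun A hA => hC _ (hmul _ (hmul _ hX _ hA) _ hY)⟩
    | zero_left Y hY => exact ⟨0, by simp⟩
    | zero_right X hX => exact ⟨0, by simp⟩
    | add_left X X' Y _ _ _ h₁ h₂ =>
      obtain ⟨C₁, h₁⟩ := h₁
      obtain ⟨C₂, h₂⟩ := h₂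
      refine ⟨C₁ + C₂, fun A hA => ?_⟩
      rw [add_mul, add_mul, map_add]
      exact (abs_add_le _ _).trans (add_le_add (h₁ A hA) (h₂ A hA))
    | add_right X Y Y' _ _ _ h₁ h₂ =>
      obtain ⟨C₁, h₁⟩ := h₁
      obtain ⟨C₂, h₂⟩ := h₂
      refine ⟨C₁ + C₂, fun A hA => ?_⟩
      rw [mul_add, map_add]
      exact (abs_add_le _ _).trans (add_le_add (h₁ A hA) (h₂ A hA))
    | smul_left c X Y _ _ h₁ =>
      obtain ⟨C, hC⟩ := h₁
      refine ⟨|c| * C, fun A hA => ?_⟩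
      rw [Matrix.smul_mul, Matrix.smul_mul, map_smul, smul_eq_mul, abs_mul]
      exact mul_le_mul_of_nonneg_left (hC A hA) (abs_nonneg c)
    | smul_right c X Y _ _ h₁ =>
      obtain ⟨C, hC⟩ := h₁
      refine ⟨|c| * C, fun A hA => ?_⟩
      rw [Matrix.mul_smul, map_smul, smul_eq_mul, abs_mul]
      exact mul_le_mul_of_nonneg_left (hC A hA) (abs_nonneg c)
  obtain ⟨a, b, hab⟩ : ∃ a b, φ (single a b 1) ≠ 0 := by
    by_contra! hcon
    refine hφ (Matrix.ext_linearMap ℝ fun i j => ?_)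
    ext
    simp [hcon]
  choose C hC using fun i j => key (single a i 1) (single j b 1)
  have hentry : ∀ A ∈ S, ∀ i j, |A i j| ≤ C i j / |φ (single a b 1)| := by
    intro A hA i j
    rw [le_div_iff₀ (abs_pos.2 hab), ← abs_mul, ← smul_eq_mul, ← map_smul]
    have := hC i j A hA
    rw [single_mul_mul_single] at this
    simpa using this
  refine ⟨∑ i, ∑ j, abs (C i j / |φ (single a b 1)|), fun A hA i j => (hentry A hA i j).trans ?_⟩
  refine (le_abs_self _).trans ((Finset.single_le_sum
    (f := fun j => abs (C i j / |φ (single a b 1)|)) (fun _ _ => abs_nonneg _)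
    (Finset.mem_univ j)).trans ?_)
  exact Finset.single_le_sum (f := fun i => ∑ j, abs (C i j / |φ (single a b 1)|))
    (fun _ _ => Finset.sum_nonneg fun _ _ => abs_nonneg _) (Finset.mem_univ i)

theorem bounded_linearMap_of_bounded_entries {n : ℕ} (S : Set (Matrix (Fin n) (Fin n) ℝ))
    (φ : Matrix (Fin n) (Fin n) ℝ →ₗ[ℝ] ℝ)
    (h : ∃ C : ℝ, ∀ A ∈ S, ∀ i j, |A i j| ≤ C) : ∃ C : ℝ, ∀ A ∈ S, |φ A| ≤ C := by
  obtain ⟨C, hC⟩ := h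
  refine ⟨∑ i, ∑ j, C * |φ (single i j 1)|, fun A hA => ?_⟩
  conv_lhs => rw [Matrix.matrix_eq_sum_single A]
  simp only [map_sum]
  refine (Finset.abs_sum_le_sum_abs _ _).trans (Finset.sum_le_sum fun i _ =>
    (Finset.abs_sum_le_sum_abs _ _).trans (Finset.sum_le_sum fun j _ => ?_))
  have : single i j (A i j) = A i j • single i j (1 : ℝ) := by simp
  rw [this, map_smul, smul_eq_mul, abs_mul]
  exact mul_le_mul_of_nonneg_right (hC A hA i j) (abs_nonneg _)

end Matrix


/-- For an irreducible semigroup `S` of triangularizable matrices in `Mₙ(ℝ)` and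
a nonzero linear functional `φ` on `Mₙ(ℝ)`, if `φ(S)` is bounded then `S` is bounded; hence
`S` is bounded iff `φ(S)` is. -/
theorem bounded_functional_image_implies_bounded_semigroup
    (n : ℕ) (hn : 1 ≤ n) (S : Set (Matrix (Fin n) (Fin n) ℝ))
    -- `S` is a multiplicative semigroup
    (hmul : ∀ A ∈ S, ∀ B ∈ S, A * B ∈ S)
    -- each member of `S` is triangularizable
    (htri : ∀ A ∈ S, ∃ P : (Matrix (Fin n) (Fin n) ℝ)ˣ,
      Matrix.BlockTriangular
        ((↑P⁻¹ : Matrix (Fin n) (Fin n) ℝ) * A * (↑P : Matrix (Fin n) (Fin n) ℝ)) id)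
    -- `S` is irreducible
    (hne : S ≠ {0})
    (hirr : ∀ W : Submodule ℝ (Fin n → ℝ),
      (∀ A ∈ S, ∀ x ∈ W, A.mulVec x ∈ W) → W = ⊥ ∨ W = ⊤)
    -- `φ` is a nonzero ℝ-linear functional on `Mₙ(ℝ)`
    (φ : Matrix (Fin n) (Fin n) ℝ →ₗ[ℝ] ℝ) (hφ : φ ≠ 0) :
    ((∃ C : ℝ, ∀ A ∈ S, |φ A| ≤ C) → ∃ C : ℝ, ∀ A ∈ S, ∀ i j, |A i j| ≤ C) ∧
    ((∃ C : ℝ, ∀ A ∈ S, ∀ i j, |A i j| ≤ C) ↔ ∃ C : ℝ, ∀ A ∈ S, |φ A| ≤ C) := by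
  have hforward : (∃ C : ℝ, ∀ A ∈ S, |φ A| ≤ C) → ∃ C : ℝ, ∀ A ∈ S, ∀ i j, |A i j| ≤ C := by
    intro hbdd
    rcases S.eq_empty_or_nonempty with rfl | hS
    · exact ⟨0, by simp⟩
    have hnz : ∃ A ∈ S, A ≠ 0 := by
      by_contra! hcon
      exact hne (Set.eq_singleton_iff_nonempty_unique_mem.2 ⟨hS, hcon⟩)
    exact Matrix.bounded_entries_of_bounded_linearMap S hmul
      (Matrix.span_eq_top_of_irreducible_of_triangularizable hmul htri hnz hirr) φ hφ hbdd
  exact ⟨hforward, Matrix.bounded_linearMap_of_bounded_entries S φ, hforward⟩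
end
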